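/- Let Σ_A be a topologically mixing one-sided countable topological Markov shift satisfying the BIP property, and let φ : Σ_A → ℝ satisfy the Walters condition with Var_1 φ < ∞ and P_G(φ) < ∞. Then there is exactly one φ-DLR probability measure on Σ_A. Moreover, a probability measure on Σ_A is φ-DLR if and only if it is non-singular and (φ,λ)-conformal for some λ > 0. -/

import Mathlib

open MeasureTheory Filter Topology ENNReal

namespace CMS

/-- A sequence is admissible for the transition matrix `A`. -/
def IsAdm (A : ℕ → ℕ → Bool) (u : ℕ → ℕ) : Prop := ∀ i, A (u i) (u (i + 1)) = true

/-- The one-sided countable topological Markov shift. -/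
abbrev Space (A : ℕ → ℕ → Bool) := {u : ℕ → ℕ // IsAdm A u}

/-- The transition matrix has no row and no column identically zero. -/
def NoDegenerate (A : ℕ → ℕ → Bool) : Prop :=
  (∀ i, ∃ j, A i j = true) ∧ (∀ j, ∃ i, A i j = true)

/-- The shift map. -/
def shift {A : ℕ → ℕ → Bool} (x : Space A) : Space A :=
  ⟨fun i => x.1 (i + 1), fun i => x.2 (i + 1)⟩

/-- Birkhoff (ergodic) sum `φ_n`. -/
noncomputable def birkhoff {A : ℕ → ℕ → Bool} (φ : Space A → ℝ) (n : ℕ) (x : Space A) : ℝ :=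
  ∑ i ∈ Finset.range n, φ (shift^[i] x)

/-- The cylinder set determined by a word. -/
def cyl (A : ℕ → ℕ → Bool) (w : List ℕ) : Set (Space A) :=
  {x | ∀ i : Fin w.length, x.1 i = w.get i}

/-- Concatenation of a finite word with a sequence. -/
def concatSeq (w : List ℕ) (u : ℕ → ℕ) : ℕ → ℕ :=
  fun i => if h : i < w.length then w.get ⟨i, h⟩ else u (i - w.length)

/-- Prepending a single symbol to a sequence. -/
def prependSeq (a : ℕ) (u : ℕ → ℕ) : ℕ → ℕ := fun i => Nat.casesOn i a u

/-- The set of points to which the symbol `a` may be prepended. -/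
def admits (A : ℕ → ℕ → Bool) (a : ℕ) : Set (Space A) := {x | A a (x.1 0) = true}

/-- Prepending a symbol to a point of the shift space (identity if not admissible). -/
noncomputable def prep (A : ℕ → ℕ → Bool) (a : ℕ) (x : Space A) : Space A :=
  if h : A a (x.1 0) = true then
    ⟨prependSeq a x.1, by
      intro i
      cases i with
      | zero => exact h
      | succ j => exact x.2 j⟩
  else x

/-- The measure `ν ⊚ σ`, `ν⊚σ(E) = Σ_a ν(σ(E ∩ [a]))`. -/
noncomputable def circ (A : ℕ → ℕ → Bool) (ν : Measure (Space A)) : Measure (Space A) :=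
  Measure.sum fun a : ℕ => (ν.restrict (admits A a)).map (prep A a)

/-- `ν` is `(φ, l)`-conformal: `dν/d(ν⊚σ) = l⁻¹ e^φ`. -/
def Conformal (A : ℕ → ℕ → Bool) (φ : Space A → ℝ) (l : ℝ) (ν : Measure (Space A)) : Prop :=
  ∀ E : Set (Space A), MeasurableSet E →
    ν E = ∫⁻ x in E, ENNReal.ofReal (l⁻¹ * Real.exp (φ x)) ∂(circ A ν)

/-- The Ruelle transfer operator. -/
noncomputable def ruelle (A : ℕ → ℕ → Bool) (φ f : Space A → ℝ) (x : Space A) : ℝ :=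
  ∑' a : ℕ, if A a (x.1 0) = true then Real.exp (φ (prep A a x)) * f (prep A a x) else 0

/-- The Ruelle operator applied to the constant function 1, valued in `ℝ≥0∞`. -/
noncomputable def ruelleOne (A : ℕ → ℕ → Bool) (φ : Space A → ℝ) (x : Space A) : ℝ≥0∞ :=
  ∑' a : ℕ, if A a (x.1 0) = true then ENNReal.ofReal (Real.exp (φ (prep A a x))) else 0

/-- `L*_φ ν = l ν` : the dual eigenmeasure equation. -/
def DualEigen (A : ℕ → ℕ → Bool) (φ : Space A → ℝ) (l : ℝ) (ν : Measure (Space A)) : Prop :=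
  ∀ f : Space A → ℝ, Integrable f ν →
    ∫ x, ruelle A φ f x ∂ν = l * ∫ x, f x ∂ν

/-- The sub-σ-algebra `σ^{-n} 𝓑`. -/
def shiftSigma (A : ℕ → ℕ → Bool) (n : ℕ) : MeasurableSpace (Space A) :=
  MeasurableSpace.comap (shift^[n]) inferInstance

/-- A sub-σ-algebra `m` is compatible with `ν`: the restriction of `ν` to `m` is σ-finite. -/
def Compatible (A : ℕ → ℕ → Bool) (ν : Measure (Space A))
    (m : MeasurableSpace (Space A)) : Prop :=
  ∃ s : ℕ → Set (Space A), (∀ k, MeasurableSet[m] (s k)) ∧ (∀ k, ν (s k) ≠ ⊤) ∧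
    (⋃ k, s k) = Set.univ

open Classical in
/-- Numerator of the DLR kernel: `e^{φ_n(w σ^n x)} 1{w σ^n x ∈ Σ_A}`. -/
noncomputable def dlrNum (A : ℕ → ℕ → Bool) (φ : Space A → ℝ) (w : List ℕ)
    (x : Space A) : ℝ :=
  if h : IsAdm A (concatSeq w ((shift^[w.length] x).1)) then
    Real.exp (birkhoff φ w.length (⟨concatSeq w ((shift^[w.length] x).1), h⟩ : Space A))
  else 0

/-- Denominator of the DLR kernel: `Σ_{y : σ^n y = σ^n x} e^{φ_n(y)}`. -/
noncomputable def dlrDen (A : ℕ → ℕ → Bool) (φ : Space A → ℝ) (n : ℕ) (x : Space A) : ℝ :=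
  ∑' y : {y : Space A // shift^[n] y = shift^[n] x}, Real.exp (birkhoff φ n y.1)

/-- `ν` is a `φ`-DLR measure. -/
def IsDLR (A : ℕ → ℕ → Bool) (φ : Space A → ℝ) (ν : Measure (Space A)) : Prop :=
  ∀ n : ℕ, 1 ≤ n →
    Compatible A ν (shiftSigma A n) ∧
    ∀ w : List ℕ, w.length = n →
      (ν[Set.indicator (cyl A w) (fun _ => (1 : ℝ))|shiftSigma A n])
        =ᵐ[ν] fun x => dlrNum A φ w x / dlrDen A φ n x

/-- `ν` is non-singular: `ν ∘ σ⁻¹ ∼ ν`. -/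
def NonSingular (A : ℕ → ℕ → Bool) (ν : Measure (Space A)) : Prop :=
  ν.map shift ≪ ν ∧ ν ≪ ν.map shift

/-- Conservative non-singular measure. -/
def Conservative (A : ℕ → ℕ → Bool) (ν : Measure (Space A)) : Prop :=
  NonSingular A ν ∧
    ∀ W : Set (Space A), MeasurableSet W →
      (∀ i j : ℕ, i ≠ j → ν ((shift^[i] ⁻¹' W) ∩ (shift^[j] ⁻¹' W)) = 0) → ν W = 0

/-- The `n`-th variation `Var_n φ`, valued in `ℝ≥0∞`. -/
noncomputable def varn (A : ℕ → ℕ → Bool) (φ : Space A → ℝ) (n : ℕ) : ℝ≥0∞ :=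
  ⨆ (x : Space A) (y : Space A) (_ : ∀ i, i < n → x.1 i = y.1 i),
    ENNReal.ofReal |φ x - φ y|

noncomputable def waltersBound (A : ℕ → ℕ → Bool) (φ : Space A → ℝ) (k : ℕ) : ℝ≥0∞ :=
  ⨆ (n : ℕ) (_ : 1 ≤ n), varn A (birkhoff φ n) (n + k)

/-- The Walters condition. -/
def Walters (A : ℕ → ℕ → Bool) (φ : Space A → ℝ) : Prop :=
  (∀ k, 1 ≤ k → waltersBound A φ k ≠ ⊤) ∧
  Tendsto (waltersBound A φ) atTop (nhds 0)

/-- `φ` is weakly Hölder continuous. -/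
def WeaklyHolder (A : ℕ → ℕ → Bool) (φ : Space A → ℝ) : Prop :=
  ∃ H θ : ℝ, 0 < H ∧ θ ∈ Set.Ioo (0 : ℝ) 1 ∧
    ∀ n : ℕ, 2 ≤ n → varn A φ n ≤ ENNReal.ofReal (H * θ ^ n)

/-- The partition function `Z_n(φ, a)`, valued in `ℝ≥0∞`. -/
noncomputable def Zn (A : ℕ → ℕ → Bool) (φ : Space A → ℝ) (n a : ℕ) : ℝ≥0∞ :=
  ∑' x : {x : Space A // shift^[n] x = x ∧ x.1 0 = a},
    ENNReal.ofReal (Real.exp (birkhoff φ n x.1))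

/-- The partition function `Z*_n(φ, a)` over periodic points whose first return to `[a]` is `n`. -/
noncomputable def Znstar (A : ℕ → ℕ → Bool) (φ : Space A → ℝ) (n a : ℕ) : ℝ≥0∞ :=
  ∑' x : {x : Space A // shift^[n] x = x ∧ x.1 0 = a ∧
      ∀ k, 0 < k → k < n → (shift^[k] x).1 0 ≠ a},
    ENNReal.ofReal (Real.exp (birkhoff φ n x.1))

/-- `P` is the (finite) Gurevich pressure of `φ`. -/
def HasGurevich (A : ℕ → ℕ → Bool) (φ : Space A → ℝ) (P : ℝ) : Prop :=
  ∀ a : ℕ, (cyl A [a]).Nonempty →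
    (∀ n, 1 ≤ n → Zn A φ n a ≠ ⊤) ∧
    Tendsto (fun n : ℕ => Real.log (Zn A φ n a).toReal / n) atTop (nhds P)

/-- `φ` is recurrent (with Gurevich pressure `P`). -/
def Recurrent (A : ℕ → ℕ → Bool) (φ : Space A → ℝ) (P : ℝ) : Prop :=
  ∀ a : ℕ, (cyl A [a]).Nonempty →
    ∑' n : ℕ, ENNReal.ofReal (Real.exp (-((n + 1 : ℕ) : ℝ) * P)) * Zn A φ (n + 1) a = ⊤

/-- `φ` is positive recurrent (with Gurevich pressure `P`). -/
def PosRecurrent (A : ℕ → ℕ → Bool) (φ : Space A → ℝ) (P : ℝ) : Prop :=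
  Recurrent A φ P ∧
  ∀ a : ℕ, (cyl A [a]).Nonempty →
    ∑' n : ℕ, ((n + 1 : ℕ) : ℝ≥0∞) *
      ENNReal.ofReal (Real.exp (-((n + 1 : ℕ) : ℝ) * P)) * Znstar A φ (n + 1) a ≠ ⊤

/-- `φ` is transient (with Gurevich pressure `P`). -/
def Transient (A : ℕ → ℕ → Bool) (φ : Space A → ℝ) (P : ℝ) : Prop :=
  ∀ a : ℕ, (cyl A [a]).Nonempty →
    ∑' n : ℕ, ENNReal.ofReal (Real.exp (-((n + 1 : ℕ) : ℝ) * P)) * Zn A φ (n + 1) a ≠ ⊤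

/-- `Σ_A` is topologically mixing. -/
def TopMixing (A : ℕ → ℕ → Bool) : Prop :=
  ∀ a b : ℕ, ∃ N : ℕ, ∀ n, N < n → ∃ x : Space A, x.1 0 = a ∧ (shift^[n] x).1 0 = b

/-- The big images and preimages (BIP) property. -/
def BIP (A : ℕ → ℕ → Bool) : Prop :=
  ∃ (N : ℕ) (b : Fin N → ℕ), ∀ a : ℕ,
    (∃ i, A (b i) a = true) ∧ (∃ j, A a (b j) = true)

/-- An admissible word. -/
def AdmWord (A : ℕ → ℕ → Bool) (w : List ℕ) : Prop :=
  ∀ (i : ℕ) (h : i + 1 < w.length),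
    A (w.get ⟨i, Nat.lt_of_succ_lt h⟩) (w.get ⟨i + 1, h⟩) = true

/-- The image of `E ⊆ [a̲]` under the cylinder-swapping map `v_{a̲,b̲}`. -/
def swapImage (A : ℕ → ℕ → Bool) (b : List ℕ) (E : Set (Space A)) : Set (Space A) :=
  {y | ∃ x ∈ E, y.1 = concatSeq b ((shift^[b.length] x).1)}

/-- The image of `E` under the prepending map `I_b`. -/
def prepImage (A : ℕ → ℕ → Bool) (b : ℕ) (E : Set (Space A)) : Set (Space A) :=
  {y | ∃ x ∈ E, y.1 = prependSeq b x.1}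

/-- The transition matrix of the renewal shift:
`A(1,1) = A(1,i) = A(i,i-1) = 1` (for `i > 1`), all other entries `0`. -/
def renA : ℕ → ℕ → Bool := fun i j => decide ((i = 1 ∧ 1 ≤ j) ∨ (2 ≤ i ∧ j = i - 1))

/-- The transition matrix of the shift `Σ_{𝓡⁻}`:
`A(i,i+1) = A(i,1) = 1` for `i ≥ 1`, all other entries `0`. -/
def rminusA : ℕ → ℕ → Bool := fun i j => decide (1 ≤ i ∧ (j = i + 1 ∨ j = 1))

/-- The periodic sequence obtained by repeating the word `w`. -/
def perSeq (w : List ℕ) : ℕ → ℕ := fun i => w.getD (i % w.length) 0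

/-- The word `(j, j-1, …, 1, n, n-1, …, j+1)`. -/
def gammaWord (j n : ℕ) : List ℕ :=
  ((List.range j).map (· + 1)).reverse ++ ((List.range (n - j)).map (· + (j + 1))).reverse

/-- The point `x̄ = (1, 2, 3, …)` of `Σ_{𝓡⁻}`. -/
def xbar : Space rminusA := ⟨fun i => i + 1, by intro i; simp [rminusA]⟩

variable {A : ℕ → ℕ → Bool} {φ : Space A → ℝ}

lemma shift_iterate_apply (n : ℕ) (x : Space A) (i : ℕ) : (shift^[n] x).1 i = x.1 (i + n) := by
  induction n generalizing x i with
  | zero => rfl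
  | succ n ih =>
    rw [Function.iterate_succ_apply, ih]
    change x.1 (i + n + 1) = _
    congr 1

lemma birkhoff_add (m n : ℕ) (y : Space A) :
    birkhoff φ (m + n) y = birkhoff φ n y + birkhoff φ m (shift^[n] y) := by
  unfold birkhoff
  rw [add_comm m n, Finset.sum_range_add]
  congr 1
  refine Finset.sum_congr rfl fun i _ => ?_
  rw [← Function.iterate_add_apply, add_comm]

lemma birkhoff_zero (y : Space A) : birkhoff φ 0 y = 0 := by simp [birkhoff]

lemma birkhoff_one (y : Space A) : birkhoff φ 1 y = φ y := by simp [birkhoff]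

/-- The exponential weight `e^{φ_n(y)}` as an extended nonnegative real. -/
noncomputable def weight (φ : Space A → ℝ) (n : ℕ) (y : Space A) : ℝ≥0∞ :=
  ENNReal.ofReal (Real.exp (birkhoff φ n y))

lemma weight_add (m n : ℕ) (y : Space A) :
    weight φ (m + n) y = weight φ n y * weight φ m (shift^[n] y) := by
  unfold weight
  rw [birkhoff_add, Real.exp_add, ENNReal.ofReal_mul (Real.exp_pos _).le]

lemma weight_zero (y : Space A) : weight φ 0 y = 1 := by simp [weight, birkhoff_zero]

lemma weight_ne_top (n : ℕ) (y : Space A) : weight φ n y ≠ ⊤ := ENNReal.ofReal_ne_top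

open Classical in
/-- The `n`-th iterate of the transfer operator, acting on `ℝ≥0∞`-valued functions:
`Σ_{σ^n y = z} e^{φ_n(y)} f(y)`. -/
noncomputable def transfer (φ : Space A → ℝ) (n : ℕ) (f : Space A → ℝ≥0∞) (z : Space A) : ℝ≥0∞ :=
  ∑' y : Space A, if shift^[n] y = z then weight φ n y * f y else 0

lemma transfer_zero (f : Space A → ℝ≥0∞) : transfer φ 0 f = f := by
  ext z
  unfold transfer
  rw [tsum_eq_single z]
  · simp [weight_zero]
  · intro y hy
    simp [hy]

lemma transfer_add (m n : ℕ) (f : Space A → ℝ≥0∞) :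
    transfer φ (m + n) f = transfer φ m (transfer φ n f) := by
  classical
  ext z
  have h : transfer φ m (transfer φ n f) z = ∑' y : Space A, ∑' u : Space A,
      if shift^[m] y = z ∧ shift^[n] u = y then weight φ m y * (weight φ n u * f u) else 0 := by
    unfold transfer
    refine tsum_congr fun y => ?_
    by_cases hy : shift^[m] y = z
    · simp only [hy, if_true, true_and]
      rw [← ENNReal.tsum_mul_left]
      refine tsum_congr fun u => ?_
      split_ifs <;> simp
    · simp [hy]
  rw [h, ENNReal.tsum_comm]
  unfold transfer
  refine tsum_congr fun u => ?_
  rw [tsum_eq_single (shift^[n] u)]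
  · simp only [and_true, Function.iterate_add_apply]
    split_ifs
    · rw [weight_add]; ring
    · rfl
  · intro y hy
    rw [if_neg]
    exact fun h => hy h.2.symm

lemma transfer_mono (n : ℕ) {f g : Space A → ℝ≥0∞} (h : ∀ y, f y ≤ g y) (z : Space A) :
    transfer φ n f z ≤ transfer φ n g z := by
  unfold transfer
  refine ENNReal.tsum_le_tsum fun y => ?_
  split_ifs
  · gcongr; exact h y
  · rfl

lemma transfer_const_mul (n : ℕ) (c : ℝ≥0∞) (f : Space A → ℝ≥0∞) (z : Space A) :
    transfer φ n (fun y => c * f y) z = c * transfer φ n f z := by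
  unfold transfer
  rw [← ENNReal.tsum_mul_left]
  refine tsum_congr fun y => ?_
  split_ifs
  · ring
  · simp

lemma transfer_comp_shift_mul (n : ℕ) (g f : Space A → ℝ≥0∞) (z : Space A) :
    transfer φ n (fun y => g (shift^[n] y) * f y) z = g z * transfer φ n f z := by
  unfold transfer
  rw [← ENNReal.tsum_mul_left]
  refine tsum_congr fun y => ?_
  split_ifs with h
  · subst h; ring
  · simp

lemma prep_apply_zero {a : ℕ} {z : Space A} (h : A a (z.1 0) = true) : (prep A a z).1 0 = a := by
  unfold prep; rw [dif_pos h]; rfl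

lemma shift_prep {a : ℕ} {z : Space A} (h : A a (z.1 0) = true) : shift (prep A a z) = z := by
  unfold prep; rw [dif_pos h]; rfl

lemma prep_shift (y : Space A) : prep A (y.1 0) (shift y) = y := by
  have h : A (y.1 0) ((shift y).1 0) = true := y.2 0
  unfold prep
  rw [dif_pos h]
  ext i
  cases i <;> rfl

lemma transfer_one (f : Space A → ℝ≥0∞) (z : Space A) :
    transfer φ 1 f z = ∑' a : ℕ, if A a (z.1 0) = true then
      ENNReal.ofReal (Real.exp (φ (prep A a z))) * f (prep A a z) else 0 := by
  classical
  have h1 : transfer φ 1 f z = ∑' y : Space A, ∑' a : ℕ,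
      if A a (z.1 0) = true ∧ prep A a z = y then
        ENNReal.ofReal (Real.exp (φ (prep A a z))) * f (prep A a z) else 0 := by
    unfold transfer
    refine tsum_congr fun y => ?_
    rw [tsum_eq_single (y.1 0)]
    · have key : (A (y.1 0) (z.1 0) = true ∧ prep A (y.1 0) z = y) ↔ shift^[1] y = z := by
        constructor
        · rintro ⟨h, h'⟩
          rw [← h']; exact shift_prep h
        · rintro rfl
          exact ⟨y.2 0, prep_shift y⟩
      simp only [key]
      split_ifs with h
      · rw [(key.2 h).2]; simp [weight, birkhoff_one]
      · rfl
    · intro a ha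
      rw [if_neg]
      rintro ⟨h, rfl⟩
      exact ha (prep_apply_zero h).symm
  rw [h1, ENNReal.tsum_comm]
  refine tsum_congr fun a => ?_
  rw [tsum_eq_single (prep A a z)]
  · simp
  · intro y hy
    rw [if_neg]
    exact fun h => hy h.2.symm

lemma continuous_coord (i : ℕ) : Continuous fun x : Space A => x.1 i :=
  (continuous_apply i).comp continuous_subtype_val

lemma continuous_shift : Continuous (shift : Space A → Space A) :=
  Continuous.subtype_mk (continuous_pi fun i => continuous_coord (i + 1)) _

lemma continuous_prep (a : ℕ) : Continuous (prep A a) := by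
  refine continuous_induced_rng.2 (continuous_pi fun i => ?_)
  have : (fun x : Space A => (Subtype.val ∘ prep A a) x i) =
      (fun p : ℕ × ℕ × ℕ => if A a p.1 = true then (if i = 0 then a else p.2.1) else p.2.2) ∘
      fun x : Space A => (x.1 0, x.1 (i - 1), x.1 i) := by
    ext x
    simp only [Function.comp, prep]
    split_ifs with h h'
    · subst h'; rfl
    · obtain ⟨j, rfl⟩ := Nat.exists_eq_succ_of_ne_zero h'; rfl
    · rfl
  rw [this]
  exact continuous_of_discreteTopology.comp
    ((continuous_coord 0).prodMk ((continuous_coord _).prodMk (continuous_coord _)))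

lemma isClopen_admits (a : ℕ) : IsClopen (admits A a) :=
  (isClopen_discrete {j : ℕ | A a j = true}).preimage (continuous_coord (A := A) 0)

lemma measurable_shift_iterate (n : ℕ) : Measurable (shift^[n] : Space A → Space A) :=
  (continuous_shift.iterate n).measurable

lemma measurableSet_admits (a : ℕ) : MeasurableSet (admits A a) :=
  (isClopen_admits a).isOpen.measurableSet

lemma measurable_transfer_one (hφ : Measurable φ) {f : Space A → ℝ≥0∞} (hf : Measurable f) :
    Measurable (transfer φ 1 f) := by
  have : transfer φ 1 f = fun z => ∑' a : ℕ, if A a (z.1 0) = true then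
      ENNReal.ofReal (Real.exp (φ (prep A a z))) * f (prep A a z) else 0 := by
    ext z; exact transfer_one f z
  rw [this]
  refine Measurable.tsum fun a => ?_
  have hp := (continuous_prep (A := A) a).measurable
  exact Measurable.ite (measurableSet_admits a) (by fun_prop) measurable_const

lemma measurable_transfer (hφ : Measurable φ) (n : ℕ) {f : Space A → ℝ≥0∞} (hf : Measurable f) :
    Measurable (transfer φ n f) := by
  induction n generalizing f with
  | zero => rwa [transfer_zero]
  | succ n ih => rw [transfer_add]; exact ih (measurable_transfer_one hφ hf)

/-- The dual of the transfer operator. -/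
noncomputable def dual (φ : Space A → ℝ) (μ : Measure (Space A)) : Measure (Space A) :=
  (circ A μ).withDensity fun x => ENNReal.ofReal (Real.exp (φ x))

lemma lintegral_dual (hφ : Measurable φ) (μ : Measure (Space A)) {f : Space A → ℝ≥0∞}
    (hf : Measurable f) : ∫⁻ x, f x ∂(dual φ μ) = ∫⁻ x, transfer φ 1 f x ∂μ := by
  have he : Measurable fun x => ENNReal.ofReal (Real.exp (φ x)) := by fun_prop
  unfold dual
  rw [lintegral_withDensity_eq_lintegral_mul _ he hf, circ, lintegral_sum_measure]
  simp_rw [transfer_one]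
  have hp := fun a => (continuous_prep (A := A) a).measurable
  rw [lintegral_tsum]
  · refine tsum_congr fun a => ?_
    rw [lintegral_map (he.mul hf) (hp a), ← lintegral_indicator (measurableSet_admits a)]
    refine lintegral_congr fun x => ?_
    by_cases h : A a (x.1 0) = true <;> simp [Set.indicator, admits, h]
  · intro a
    exact (Measurable.ite (measurableSet_admits a)
      ((he.comp (hp a)).mul (hf.comp (hp a))) measurable_const).aemeasurable

lemma lintegral_dual_iterate (hφ : Measurable φ) (n : ℕ) (μ : Measure (Space A))
    {f : Space A → ℝ≥0∞} (hf : Measurable f) :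
    ∫⁻ x, f x ∂((dual φ)^[n] μ) = ∫⁻ x, transfer φ n f x ∂μ := by
  induction n generalizing μ with
  | zero => simp [transfer_zero]
  | succ n ih =>
    rw [Function.iterate_succ_apply, ih, lintegral_dual hφ _ (measurable_transfer hφ n hf),
      add_comm n 1, transfer_add]

lemma dual_apply (hφ : Measurable φ) (μ : Measure (Space A)) {E : Set (Space A)}
    (hE : MeasurableSet E) : dual φ μ E = ∫⁻ x, transfer φ 1 (E.indicator 1) x ∂μ := by
  rw [← lintegral_dual hφ μ (measurable_one.indicator hE), lintegral_indicator_one hE]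

lemma dual_smul (c : ℝ≥0∞) (μ : Measure (Space A)) : dual φ (c • μ) = c • dual φ μ := by
  unfold dual circ
  rw [← withDensity_smul_measure]
  congr 1
  ext s hs
  simp [Measure.sum_apply _ hs, ENNReal.tsum_mul_left]

lemma conformal_iff (l : ℝ) (hl : 0 < l) (μ : Measure (Space A)) :
    Conformal A φ l μ ↔ μ = ENNReal.ofReal l⁻¹ • dual φ μ := by
  have h : ∀ E : Set (Space A), MeasurableSet E →
      ∫⁻ x in E, ENNReal.ofReal (l⁻¹ * Real.exp (φ x)) ∂(circ A μ)
        = (ENNReal.ofReal l⁻¹ • dual φ μ) E := by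
    intro E hE
    rw [Measure.smul_apply, dual, withDensity_apply _ hE, smul_eq_mul,
      ← lintegral_const_mul' _ _ ENNReal.ofReal_ne_top]
    refine lintegral_congr fun x => ?_
    rw [ENNReal.ofReal_mul (by positivity)]
  constructor
  · intro hc
    ext E hE
    rw [hc E hE, h E hE]
  · intro hc E hE
    rw [h E hE, ← hc]

lemma abs_sub_le_of_varn_le {f : Space A → ℝ} {n : ℕ} {c : ℝ≥0∞} (hc : c ≠ ⊤)
    (h : varn A f n ≤ c) {x y : Space A} (hxy : ∀ i, i < n → x.1 i = y.1 i) :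
    |f x - f y| ≤ c.toReal := by
  have h1 : ENNReal.ofReal |f x - f y| ≤ c := by
    refine le_trans ?_ h
    unfold varn
    exact le_iSup_of_le x (le_iSup_of_le y (le_iSup_of_le hxy le_rfl))
  exact (ENNReal.ofReal_le_iff_le_toReal hc).1 h1

lemma varn_birkhoff_le_waltersBound {n : ℕ} (hn : 1 ≤ n) (k : ℕ) :
    varn A (birkhoff φ n) (n + k) ≤ waltersBound A φ k := by
  unfold waltersBound
  exact le_iSup_of_le n (le_iSup_of_le hn le_rfl)

lemma exists_distortion (hw : Walters A φ) (hvar : varn A φ 1 ≠ ⊤) :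
    ∃ C : ℝ, 0 ≤ C ∧ ∀ (s : ℕ) (x y : Space A), (∀ i, i < s → x.1 i = y.1 i) →
      birkhoff φ s x ≤ birkhoff φ s y + C := by
  have hW := hw.1 1 le_rfl
  refine ⟨(waltersBound A φ 1).toReal + (varn A φ 1).toReal, by positivity, ?_⟩
  intro s x y hxy
  cases s with
  | zero => simp only [birkhoff_zero]; positivity
  | succ s =>
    rw [add_comm s 1, birkhoff_add, birkhoff_add, birkhoff_one, birkhoff_one]
    have h2 : |φ (shift^[s] x) - φ (shift^[s] y)| ≤ (varn A φ 1).toReal := by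
      refine abs_sub_le_of_varn_le hvar le_rfl fun i hi => ?_
      rw [shift_iterate_apply, shift_iterate_apply]
      exact hxy _ (by omega)
    have h1 : birkhoff φ s x - birkhoff φ s y ≤ (waltersBound A φ 1).toReal := by
      rcases Nat.eq_zero_or_pos s with rfl | hs
      · simp [birkhoff_zero]
      · exact (le_abs_self _).trans (abs_sub_le_of_varn_le hW
          (varn_birkhoff_le_waltersBound hs 1) hxy)
    have := le_abs_self (φ (shift^[s] x) - φ (shift^[s] y))
    linarith

lemma eventually_prefix_eq (n : ℕ) (x : Space A) :
    ∀ᶠ y in 𝓝 x, ∀ i, i < n → y.1 i = x.1 i := by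
  have h : ∀ i ∈ Finset.range n, ∀ᶠ y in 𝓝 x, y.1 i = x.1 i := fun i _ =>
    (continuous_coord (A := A) i).continuousAt.eventually
      (by simp : ∀ᶠ j in 𝓝 (x.1 i), j = x.1 i)
  filter_upwards [(Filter.eventually_all_finset _).2 h] with y hy i hi
  exact hy i (Finset.mem_range.2 hi)

lemma continuous_of_walters (hw : Walters A φ) : Continuous φ := by
  rw [continuous_iff_continuousAt]
  intro x
  rw [ContinuousAt, Metric.tendsto_nhds]
  intro ε hε
  have h1 := hw.2.eventually (gt_mem_nhds (ENNReal.ofReal_pos.2 hε))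
  obtain ⟨k, hk⟩ := h1.exists
  filter_upwards [eventually_prefix_eq (1 + k) x] with y hy
  have h2 : |birkhoff φ 1 y - birkhoff φ 1 x| ≤ (waltersBound A φ k).toReal :=
    abs_sub_le_of_varn_le hk.ne_top (varn_birkhoff_le_waltersBound le_rfl k) hy
  rw [birkhoff_one, birkhoff_one] at h2
  rw [Real.dist_eq]
  exact h2.trans_lt (by
    rw [← ENNReal.toReal_ofReal hε.le]
    exact ENNReal.toReal_strict_mono ENNReal.ofReal_ne_top hk)

/-- The sequence `u_0 … u_{s-1} z_0 z_1 …`. -/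
def glueSeq (s : ℕ) (u z : ℕ → ℕ) : ℕ → ℕ := fun i => if i < s then u i else z (i - s)

lemma isAdm_glueSeq {s : ℕ} {u z : ℕ → ℕ} (hu : ∀ i, i < s → A (u i) (u (i + 1)) = true)
    (hz : IsAdm A z) (h : u s = z 0) : IsAdm A (glueSeq s u z) := by
  intro i
  unfold glueSeq
  by_cases h1 : i + 1 < s
  · rw [if_pos (by omega), if_pos h1]; exact hu i (by omega)
  by_cases h2 : i < s
  · rw [if_pos h2, if_neg h1]
    have h3 : i + 1 = s := by omega
    have := hu i h2
    rw [h3, h] at this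
    simpa [h3] using this
  · rw [if_neg h2, if_neg h1, show i + 1 - s = (i - s) + 1 by omega]
    exact hz _

lemma shift_iterate_eq_of_glueSeq {s : ℕ} {u : ℕ → ℕ} {z y : Space A}
    (h : y.1 = glueSeq s u z.1) : shift^[s] y = z := by
  ext i
  rw [shift_iterate_apply, h]
  simp [glueSeq]

lemma eq_of_prefix_of_shift_iterate {s : ℕ} {u v : Space A} (h : ∀ i, i < s → u.1 i = v.1 i)
    (h' : shift^[s] u = shift^[s] v) : u = v := by
  ext i
  by_cases hi : i < s
  · exact h i hi
  · have := congrArg (fun x : Space A => x.1 (i - s)) h'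
    simp only [shift_iterate_apply] at this
    rwa [Nat.sub_add_cancel (by omega)] at this

lemma transfer_eq_tsum_subtype (n : ℕ) (f : Space A → ℝ≥0∞) (z : Space A) :
    transfer φ n f z = ∑' y : {y : Space A // shift^[n] y = z}, weight φ n y.1 * f y.1 := by
  have := tsum_subtype {y : Space A | shift^[n] y = z} (fun y => weight φ n y * f y)
  refine Eq.trans ?_ this.symm
  unfold transfer
  refine tsum_congr fun y => ?_
  by_cases h : shift^[n] y = z <;> simp [Set.indicator, h]

/-- `f` depends only on the first `s` coordinates. -/
def DependsOnPrefix (s : ℕ) (f : Space A → ℝ≥0∞) : Prop :=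
  ∀ x y : Space A, (∀ i, i < s → x.1 i = y.1 i) → f x = f y

lemma transfer_le_of_apply_zero_eq {C : ℝ}
    (hC : ∀ (s : ℕ) (x y : Space A), (∀ i, i < s → x.1 i = y.1 i) →
      birkhoff φ s x ≤ birkhoff φ s y + C)
    {s : ℕ} {f : Space A → ℝ≥0∞} (hf : DependsOnPrefix s f) {y y' : Space A}
    (hy : y.1 0 = y'.1 0) :
    transfer φ s f y ≤ ENNReal.ofReal (Real.exp C) * transfer φ s f y' := by
  rw [transfer_eq_tsum_subtype, transfer_eq_tsum_subtype, ← ENNReal.tsum_mul_left]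
  have hadm : ∀ u : {u : Space A // shift^[s] u = y}, IsAdm A (glueSeq s u.1.1 y'.1) := by
    intro u
    refine isAdm_glueSeq (fun i _ => u.1.2 i) y'.2 ?_
    rw [← hy, ← congrArg (fun x : Space A => x.1 0) u.2]
    simp [shift_iterate_apply]
  let Φ : {u : Space A // shift^[s] u = y} → {u : Space A // shift^[s] u = y'} := fun u =>
    ⟨⟨glueSeq s u.1.1 y'.1, hadm u⟩, shift_iterate_eq_of_glueSeq rfl⟩
  have hΦ : ∀ u, ∀ i, i < s → u.1.1 i = (Φ u).1.1 i := by
    intro u i hi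
    simp [Φ, glueSeq, hi]
  have hinj : Function.Injective Φ := by
    intro u v huv
    apply Subtype.ext
    refine eq_of_prefix_of_shift_iterate (s := s) (fun i hi => ?_) (u.2.trans v.2.symm)
    rw [hΦ u i hi, hΦ v i hi, huv]
  refine le_trans (ENNReal.tsum_le_tsum fun u => ?_)
    (ENNReal.tsum_comp_le_tsum_of_injective hinj _)
  rw [← mul_assoc, hf u.1 (Φ u).1 (hΦ u)]
  gcongr
  unfold weight
  rw [← ENNReal.ofReal_mul (Real.exp_pos _).le, ← Real.exp_add]
  refine ENNReal.ofReal_le_ofReal (Real.exp_le_exp.2 ?_)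
  have := hC s u.1 (Φ u).1 (hΦ u)
  linarith

lemma exists_connecting_word (hmix : TopMixing A) (hbip : BIP A) :
    ∃ q : ℕ, 1 ≤ q ∧ ∃ F : Finset ℕ, ∀ a b : ℕ, ∃ w : ℕ → ℕ, w 0 = a ∧ w q = b ∧
      (∀ i, i < q → A (w i) (w (i + 1)) = true) ∧ ∀ i, 0 < i → i < q → w i ∈ F := by
  obtain ⟨N, b, hb⟩ := hbip
  choose M hM using hmix
  let l : ℕ := (∑ i : Fin N, ∑ j : Fin N, M (b i) (b j)) + 1
  have hl : ∀ i j, M (b i) (b j) < l := by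
    intro i j
    have h1 : M (b i) (b j) ≤ ∑ j : Fin N, M (b i) (b j) :=
      Finset.single_le_sum (f := fun j => M (b i) (b j)) (fun _ _ => Nat.zero_le _)
        (Finset.mem_univ j)
    have h2 : ∑ j : Fin N, M (b i) (b j) ≤ ∑ i : Fin N, ∑ j : Fin N, M (b i) (b j) :=
      Finset.single_le_sum (f := fun i => ∑ j : Fin N, M (b i) (b j)) (fun _ _ => Nat.zero_le _)
        (Finset.mem_univ i)
    omega
  have hx : ∀ i j, ∃ x : Space A, x.1 0 = b i ∧ x.1 l = b j := by
    intro i j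
    obtain ⟨x, h0, h1⟩ := hM (b i) (b j) l (hl i j)
    rw [shift_iterate_apply, zero_add] at h1
    exact ⟨x, h0, h1⟩
  choose x hx0 hxl using hx
  refine ⟨l + 2, by omega, Finset.univ.biUnion fun i : Fin N => Finset.univ.biUnion
    fun j : Fin N => (Finset.range (l + 1)).image (x i j).1, fun a c => ?_⟩
  obtain ⟨-, i, hi⟩ := hb a
  obtain ⟨⟨j, hj⟩, -⟩ := hb c
  refine ⟨fun k => if k = 0 then a else if k < l + 2 then (x i j).1 (k - 1) else c,
    by simp, by simp, ?_, ?_⟩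
  · intro k hk
    rcases Nat.eq_zero_or_pos k with rfl | hk0
    · simp [hx0, hi]
    · by_cases hk1 : k + 1 < l + 2
      · have h3 := (x i j).2 (k - 1)
        rw [Nat.sub_add_cancel hk0] at h3
        simp [hk0.ne', hk1, hk, h3]
      · have : k = l + 1 := by omega
        subst this
        simp [hxl, hj]
  · intro k hk0 hk
    simp only [hk0.ne', if_false, hk, if_true, Finset.mem_biUnion, Finset.mem_univ, true_and,
      Finset.mem_image, Finset.mem_range]
    exact ⟨i, j, k - 1, by omega, rfl⟩

lemma exists_lower_bound (hvar : varn A φ 1 ≠ ⊤) (F : Finset ℕ) :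
    ∃ B : ℝ, 0 ≤ B ∧ ∀ x : Space A, x.1 0 ∈ F → -B ≤ φ x := by
  induction F using Finset.induction_on with
  | empty => exact ⟨0, le_rfl, fun x hx => by simp at hx⟩
  | insert a F _ ih =>
    obtain ⟨B, hB0, hB⟩ := ih
    by_cases hne : ∃ y : Space A, y.1 0 = a
    · obtain ⟨y, hy⟩ := hne
      refine ⟨B + |φ y| + (varn A φ 1).toReal, by positivity, fun x hx => ?_⟩
      have hpos : 0 ≤ (varn A φ 1).toReal := ENNReal.toReal_nonneg
      rcases Finset.mem_insert.1 hx with h | h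
      · have h1 : |φ x - φ y| ≤ (varn A φ 1).toReal := by
          refine abs_sub_le_of_varn_le hvar le_rfl fun i hi => ?_
          rw [Nat.lt_one_iff.1 hi, h, hy]
        have := neg_abs_le (φ x - φ y)
        have := neg_abs_le (φ y)
        linarith
      · have := hB x h
        have := abs_nonneg (φ y)
        linarith
    · refine ⟨B, hB0, fun x hx => ?_⟩
      rcases Finset.mem_insert.1 hx with h | h
      · exact absurd ⟨x, h⟩ hne
      · exact hB x h

lemma le_birkhoff_of_mem {F : Finset ℕ} {B : ℝ} (hB0 : 0 ≤ B)
    (hB : ∀ x : Space A, x.1 0 ∈ F → -B ≤ φ x) {q : ℕ} (hq : 1 ≤ q) {x : Space A}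
    (hx : ∀ i, 0 < i → i < q → x.1 i ∈ F) : φ x ≤ birkhoff φ q x + q * B := by
  obtain ⟨r, rfl⟩ := Nat.exists_eq_add_of_le' hq
  rw [birkhoff_add, birkhoff_one]
  have h : -(r * B) ≤ birkhoff φ r (shift^[1] x) := by
    unfold birkhoff
    have : ∑ i ∈ Finset.range r, -B ≤ ∑ i ∈ Finset.range r, φ (shift^[i] (shift^[1] x)) := by
      refine Finset.sum_le_sum fun i hi => hB _ ?_
      rw [shift_iterate_apply, shift_iterate_apply]
      exact hx _ (by omega) (by have := Finset.mem_range.1 hi; omega)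
    simpa using this
  push_cast
  nlinarith

lemma exists_periodic {p : ℕ} (hp : 1 ≤ p) {w : ℕ → ℕ}
    (hw : ∀ i, i < p → A (w i) (w (i + 1)) = true) (hwp : w p = w 0) :
    ∃ x : Space A, shift^[p] x = x ∧ ∀ i, i < p → x.1 i = w i := by
  refine ⟨⟨fun i => w (i % p), fun i => ?_⟩, ?_, ?_⟩
  · have h1 := hw (i % p) (Nat.mod_lt _ hp)
    have h2 : w ((i + 1) % p) = w (i % p + 1) := by
      by_cases h : i % p + 1 = p
      · rw [← Nat.mod_add_mod, h, Nat.mod_self, hwp]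
      · have := Nat.mod_lt i hp
        rw [← Nat.mod_add_mod, Nat.mod_eq_of_lt (by omega)]
    simp only
    rw [h2]; exact h1
  · ext i
    rw [shift_iterate_apply]
    simp
  · intro i hi
    simp [Nat.mod_eq_of_lt hi]

/-- Uniform bounds on the transfer operator: domination of `e^φ` by a summable function of the
first symbol, a lower bound for the image of `1`, and a Harnack-type comparison of its values at
any two points. -/
structure UniformBounds (φ : Space A → ℝ) (u : ℕ → ℝ≥0∞) (m K : ℝ≥0∞) (q : ℕ) : Prop where
  tsum_ne_top : ∑' a, u a ≠ ⊤
  exp_le : ∀ x : Space A, ENNReal.ofReal (Real.exp (φ x)) ≤ u (x.1 0)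
  lower_ne_zero : m ≠ 0
  lower_le : ∀ z : Space A, m ≤ transfer φ 1 1 z
  const_ne_top : K ≠ ⊤
  harnack : ∀ (s : ℕ) (f : Space A → ℝ≥0∞), DependsOnPrefix s f → ∀ z z' : Space A,
    transfer φ (q + s) f z' ≤ K * transfer φ (q + s) f z

lemma transfer_one_le_tsum {u : ℕ → ℝ≥0∞}
    (hu : ∀ x : Space A, ENNReal.ofReal (Real.exp (φ x)) ≤ u (x.1 0)) (h : ℕ → ℝ≥0∞)
    (z : Space A) : transfer φ 1 (fun y => h (y.1 0)) z ≤ ∑' a, u a * h a := by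
  rw [transfer_one]
  refine ENNReal.tsum_le_tsum fun a => ?_
  split_ifs with ha
  · have := hu (prep A a z)
    rw [prep_apply_zero ha] at this ⊢
    gcongr
  · exact zero_le

lemma transfer_one_one_le {u : ℕ → ℝ≥0∞}
    (hu : ∀ x : Space A, ENNReal.ofReal (Real.exp (φ x)) ≤ u (x.1 0)) (z : Space A) :
    transfer φ 1 1 z ≤ ∑' a, u a := by
  have := transfer_one_le_tsum hu (fun _ => 1) z
  simp only [mul_one] at this
  exact this

lemma transfer_const (n : ℕ) (c : ℝ≥0∞) (z : Space A) :
    transfer φ n (fun _ => c) z = c * transfer φ n 1 z := by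
  rw [← transfer_const_mul]
  simp

lemma transfer_le_pow_mul {u : ℕ → ℝ≥0∞}
    (hu : ∀ x : Space A, ENNReal.ofReal (Real.exp (φ x)) ≤ u (x.1 0)) (n : ℕ) (z : Space A) :
    transfer φ n 1 z ≤ (∑' a, u a) ^ n := by
  induction n with
  | zero => simp [transfer_zero]
  | succ n ih =>
    rw [transfer_add]
    refine (transfer_mono n (transfer_one_one_le hu) z).trans ?_
    rw [transfer_const, pow_succ']
    gcongr

lemma exists_summable_bound (hmix : TopMixing A) (hbip : BIP A) (hvar : varn A φ 1 ≠ ⊤)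
    (hZ : ∀ n, 1 ≤ n → Zn A φ n 0 ≠ ⊤) :
    ∃ u : ℕ → ℝ≥0∞, ∑' a, u a ≠ ⊤ ∧
      ∀ x : Space A, ENNReal.ofReal (Real.exp (φ x)) ≤ u (x.1 0) := by
  obtain ⟨q, hq, F, hF⟩ := exists_connecting_word hmix hbip
  obtain ⟨B, hB0, hB⟩ := exists_lower_bound hvar (insert 0 F)
  have hper : ∀ a : ℕ, ∃ x : Space A, (shift^[q + q] x = x ∧ x.1 0 = 0) ∧ x.1 q = a ∧
      φ (shift^[q] x) ≤ birkhoff φ (q + q) x + (B + q * B + q * B) := by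
    intro a
    obtain ⟨w, hw0, hwq, hw, hwF⟩ := hF 0 a
    obtain ⟨v, hv0, hvq, hv, hvF⟩ := hF a 0
    obtain ⟨x, hx, hxw⟩ := exists_periodic (A := A) (p := q + q) (by omega)
      (w := fun i => if i < q then w i else v (i - q)) (by
        intro i hi
        by_cases h1 : i + 1 < q
        · simp only [h1, if_true, show i < q by omega]
          exact hw i (by omega)
        by_cases h2 : i < q
        · have h3 : i + 1 = q := by omega
          have := hw i h2
          rw [h3, hwq] at this
          simpa [h2, h3, hv0] using this
        · have := hv (i - q) (by omega)
          simpa [h1, h2, show i + 1 - q = i - q + 1 by omega] using this)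
      (by simp [hvq, hw0, show 0 < q by omega])
    have hx0 : x.1 0 = 0 := by
      rw [hxw 0 (by omega)]; simp [hw0, show 0 < q by omega]
    refine ⟨x, ⟨hx, hx0⟩, ?_, ?_⟩
    · rw [hxw q (by omega)]; simp [hv0]
    · rw [birkhoff_add]
      have h1 := le_birkhoff_of_mem hB0 hB hq (x := x) (fun i h0 hi => by
        rw [hxw i (by omega), if_pos hi]
        exact Finset.mem_insert_of_mem (hwF i h0 hi))
      have h2 := le_birkhoff_of_mem hB0 hB hq (x := shift^[q] x) (fun i h0 hi => by
        rw [shift_iterate_apply, hxw _ (by omega), if_neg (by omega), Nat.add_sub_cancel]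
        exact Finset.mem_insert_of_mem (hvF i h0 hi))
      have h3 := hB x (by rw [hx0]; exact Finset.mem_insert_self _ _)
      linarith
  choose x hx hxq hxφ using hper
  let D : ℝ := B + q * B + q * B
  refine ⟨fun a => ENNReal.ofReal (Real.exp (varn A φ 1).toReal) *
    ENNReal.ofReal (Real.exp (φ (shift^[q] (x a)))), ?_, ?_⟩
  · rw [ENNReal.tsum_mul_left]
    refine ENNReal.mul_ne_top ENNReal.ofReal_ne_top ?_
    have h1 : ∑' a, ENNReal.ofReal (Real.exp (φ (shift^[q] (x a)))) ≤
        ∑' a, ENNReal.ofReal (Real.exp D) *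
          ENNReal.ofReal (Real.exp (birkhoff φ (q + q) (x a))) := by
      refine ENNReal.tsum_le_tsum fun a => ?_
      rw [← ENNReal.ofReal_mul (Real.exp_pos _).le, ← Real.exp_add]
      refine ENNReal.ofReal_le_ofReal (Real.exp_le_exp.2 ?_)
      have := hxφ a
      simp only [D]
      linarith
    refine ne_top_of_le_ne_top ?_ h1
    rw [ENNReal.tsum_mul_left]
    refine ENNReal.mul_ne_top ENNReal.ofReal_ne_top (ne_top_of_le_ne_top (hZ (q + q) (by omega)) ?_)
    have hinj : Function.Injective fun a => (⟨x a, hx a⟩ :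
        {x : Space A // shift^[q + q] x = x ∧ x.1 0 = 0}) := by
      intro a b hab
      have : x a = x b := congrArg Subtype.val hab
      rw [← hxq a, ← hxq b, this]
    exact ENNReal.tsum_comp_le_tsum_of_injective hinj
      fun y => ENNReal.ofReal (Real.exp (birkhoff φ (q + q) y.1))
  · intro y
    simp only
    rw [← ENNReal.ofReal_mul (Real.exp_pos _).le, ← Real.exp_add]
    refine ENNReal.ofReal_le_ofReal (Real.exp_le_exp.2 ?_)
    have h1 : |φ y - φ (shift^[q] (x (y.1 0)))| ≤ (varn A φ 1).toReal := by
      refine abs_sub_le_of_varn_le hvar le_rfl fun i hi => ?_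
      rw [Nat.lt_one_iff.1 hi, shift_iterate_apply, zero_add, hxq]
    have := le_abs_self (φ y - φ (shift^[q] (x (y.1 0))))
    linarith

lemma exists_lower_transfer (hbip : BIP A) (hvar : varn A φ 1 ≠ ⊤) :
    ∃ m : ℝ≥0∞, m ≠ 0 ∧ ∀ z : Space A, m ≤ transfer φ 1 1 z := by
  obtain ⟨N, b, hb⟩ := hbip
  obtain ⟨B, -, hB⟩ := exists_lower_bound hvar (Finset.univ.image b)
  refine ⟨ENNReal.ofReal (Real.exp (-B)), by simp [Real.exp_pos], fun z => ?_⟩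
  obtain ⟨⟨i, hi⟩, -⟩ := hb (z.1 0)
  rw [transfer_one]
  refine le_trans ?_ (ENNReal.le_tsum (b i))
  rw [if_pos hi]
  simp only [Pi.one_apply, mul_one]
  refine ENNReal.ofReal_le_ofReal (Real.exp_le_exp.2 (hB _ ?_))
  rw [prep_apply_zero hi]
  simp

lemma exists_harnack (hmix : TopMixing A) (hbip : BIP A) (hw : Walters A φ)
    (hvar : varn A φ 1 ≠ ⊤) {u : ℕ → ℝ≥0∞} (hsum : ∑' a, u a ≠ ⊤)
    (hu : ∀ x : Space A, ENNReal.ofReal (Real.exp (φ x)) ≤ u (x.1 0)) :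
    ∃ (q : ℕ) (K : ℝ≥0∞), K ≠ ⊤ ∧ ∀ (s : ℕ) (f : Space A → ℝ≥0∞), DependsOnPrefix s f →
      ∀ z z' : Space A, transfer φ (q + s) f z' ≤ K * transfer φ (q + s) f z := by
  obtain ⟨q, hq, F, hF⟩ := exists_connecting_word hmix hbip
  obtain ⟨B, hB0, hB⟩ := exists_lower_bound hvar F
  obtain ⟨C, hC0, hC⟩ := exists_distortion hw hvar
  let V : ℝ := (varn A φ 1).toReal
  have hpt : ∀ (z : Space A) (a : ℕ), ∃ y : Space A, y.1 0 = a ∧ shift^[q] y = z ∧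
      φ y ≤ birkhoff φ q y + q * B := by
    intro z a
    obtain ⟨w, hw0, hwq, hw, hwF⟩ := hF a (z.1 0)
    refine ⟨⟨glueSeq q w z.1, isAdm_glueSeq hw z.2 hwq⟩, ?_,
      shift_iterate_eq_of_glueSeq rfl, le_birkhoff_of_mem hB0 hB hq fun i h0 hi => ?_⟩
    · simp [glueSeq, show 0 < q by omega, hw0]
    · simpa [glueSeq, hi] using hwF i h0 hi
  refine ⟨q, ENNReal.ofReal (Real.exp (V + q * B)) * ENNReal.ofReal (Real.exp C) *
    (∑' a, u a) ^ (q - 1), ?_, fun s f hf z z' => ?_⟩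
  · exact ENNReal.mul_ne_top (ENNReal.mul_ne_top ENNReal.ofReal_ne_top ENNReal.ofReal_ne_top)
      (ENNReal.pow_ne_top hsum)
  rw [transfer_add]
  set g := transfer φ s f with hg
  choose Y hY0 hYz hYφ using hpt z
  have hinj : Function.Injective Y := fun a b hab => by rw [← hY0 a, ← hY0 b, hab]
  let H : ℝ≥0∞ := ∑' a, weight φ q (Y a) * g (Y a)
  have hH : H ≤ transfer φ q g z := by
    classical
    have := ENNReal.tsum_comp_le_tsum_of_injective hinj
      (fun y => if shift^[q] y = z then weight φ q y * g y else 0)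
    simp only [hYz, if_true] at this
    exact this
  have hone : ∀ t : Space A, transfer φ 1 g t ≤
      ENNReal.ofReal (Real.exp (V + q * B)) * ENNReal.ofReal (Real.exp C) * H := by
    intro t
    rw [transfer_one, ← ENNReal.tsum_mul_left]
    refine ENNReal.tsum_le_tsum fun a => ?_
    split_ifs with ha
    · have h0 : (prep A a t).1 0 = (Y a).1 0 := by rw [prep_apply_zero ha, hY0]
      have h1 := transfer_le_of_apply_zero_eq hC hf h0
      have h2 : ENNReal.ofReal (Real.exp (φ (prep A a t))) ≤
          ENNReal.ofReal (Real.exp (V + q * B)) * weight φ q (Y a) := by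
        unfold weight
        rw [← ENNReal.ofReal_mul (Real.exp_pos _).le, ← Real.exp_add]
        refine ENNReal.ofReal_le_ofReal (Real.exp_le_exp.2 ?_)
        have h3 : |φ (prep A a t) - φ (Y a)| ≤ V :=
          abs_sub_le_of_varn_le hvar le_rfl fun i hi => by rw [Nat.lt_one_iff.1 hi, h0]
        have := le_abs_self (φ (prep A a t) - φ (Y a))
        have := hYφ a
        linarith
      calc _ ≤ (ENNReal.ofReal (Real.exp (V + q * B)) * weight φ q (Y a)) *
            (ENNReal.ofReal (Real.exp C) * g (Y a)) := mul_le_mul' h2 h1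
        _ = _ := by ring
    · exact zero_le
  calc transfer φ q g z' = transfer φ (q - 1) (transfer φ 1 g) z' := by
        rw [← transfer_add (q - 1) 1, Nat.sub_add_cancel hq]
    _ ≤ _ := transfer_mono _ hone z'
    _ = ENNReal.ofReal (Real.exp (V + q * B)) * ENNReal.ofReal (Real.exp C) * H *
        transfer φ (q - 1) 1 z' := transfer_const _ _ _
    _ ≤ ENNReal.ofReal (Real.exp (V + q * B)) * ENNReal.ofReal (Real.exp C) *
        transfer φ q g z * (∑' a, u a) ^ (q - 1) := by
      gcongr
      exact transfer_le_pow_mul hu _ _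
    _ = _ := by ring

lemma exists_uniformBounds (hmix : TopMixing A) (hbip : BIP A) (hw : Walters A φ)
    (hvar : varn A φ 1 ≠ ⊤) (hZ : ∀ n, 1 ≤ n → Zn A φ n 0 ≠ ⊤) :
    ∃ (u : ℕ → ℝ≥0∞) (m K : ℝ≥0∞) (q : ℕ), UniformBounds φ u m K q := by
  obtain ⟨u, hsum, hu⟩ := exists_summable_bound hmix hbip hvar hZ
  obtain ⟨m, hm0, hm⟩ := exists_lower_transfer hbip hvar
  obtain ⟨q, K, hK, hq⟩ := exists_harnack hmix hbip hw hvar hsum hu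
  exact ⟨u, m, K, q, hsum, hu, hm0, hm, hK, hq⟩

namespace UniformBounds

variable {u : ℕ → ℝ≥0∞} {m K : ℝ≥0∞} {q : ℕ}

lemma pow_le_transfer (h : UniformBounds φ u m K q) (n : ℕ) (z : Space A) :
    m ^ n ≤ transfer φ n 1 z := by
  induction n with
  | zero => simp [transfer_zero]
  | succ n ih =>
    rw [transfer_add]
    refine le_trans ?_ (transfer_mono n h.lower_le z)
    rw [transfer_const, pow_succ']
    gcongr

lemma transfer_ne_zero (h : UniformBounds φ u m K q) (n : ℕ) (z : Space A) :
    transfer φ n 1 z ≠ 0 := fun h0 =>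
  pow_ne_zero n h.lower_ne_zero (le_antisymm ((h.pow_le_transfer n z).trans h0.le) zero_le)

lemma transfer_ne_top (h : UniformBounds φ u m K q) (n : ℕ) (z : Space A) :
    transfer φ n 1 z ≠ ⊤ :=
  ne_top_of_le_ne_top (ENNReal.pow_ne_top h.tsum_ne_top) (transfer_le_pow_mul h.exp_le n z)

end UniformBounds

/-- The normalised kernel `x ↦ (Lⁿ f / Lⁿ 1)(σⁿ x)`, the candidate conditional expectation of `f`
given `σ^{-n} 𝓑`. -/
noncomputable def gibbsKernel (φ : Space A → ℝ) (n : ℕ) (f : Space A → ℝ≥0∞) (x : Space A) :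
    ℝ≥0∞ := transfer φ n f (shift^[n] x) / transfer φ n 1 (shift^[n] x)

/-- `μ` is invariant under the normalised kernel of order `n`. -/
def IsGibbs (φ : Space A → ℝ) (n : ℕ) (μ : Measure (Space A)) : Prop :=
  ∀ f : Space A → ℝ≥0∞, Measurable f → ∫⁻ x, f x ∂μ = ∫⁻ x, gibbsKernel φ n f x ∂μ

lemma measurable_gibbsKernel (hφ : Measurable φ) (n : ℕ) {f : Space A → ℝ≥0∞}
    (hf : Measurable f) : Measurable (gibbsKernel φ n f) :=
  ((measurable_transfer hφ n hf).div (measurable_transfer hφ n measurable_one)).comp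
    (measurable_shift_iterate n)

/-- The measure `E ↦ ∫ (Lⁿ 1_E / Lⁿ 1)(σⁿ x) dμ(x)`. -/
noncomputable def gibbsMeasure (φ : Space A → ℝ) (n : ℕ) (μ : Measure (Space A)) :
    Measure (Space A) :=
  (dual φ)^[n] ((μ.map (shift^[n])).withDensity fun z => (transfer φ n 1 z)⁻¹)

lemma lintegral_gibbsMeasure (hφ : Measurable φ) (n : ℕ) (μ : Measure (Space A))
    {f : Space A → ℝ≥0∞} (hf : Measurable f) :
    ∫⁻ x, f x ∂(gibbsMeasure φ n μ) = ∫⁻ x, gibbsKernel φ n f x ∂μ := by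
  have h1 := measurable_transfer hφ n hf
  have h2 : Measurable fun z : Space A => (transfer φ n 1 z)⁻¹ :=
    (measurable_transfer hφ n measurable_one).inv
  unfold gibbsMeasure
  rw [lintegral_dual_iterate hφ n _ hf, lintegral_withDensity_eq_lintegral_mul _ h2 h1,
    lintegral_map (h2.mul h1) (measurable_shift_iterate n)]
  refine lintegral_congr fun x => ?_
  simp only [Pi.mul_apply, gibbsKernel]
  rw [div_eq_mul_inv, mul_comm]

lemma gibbsMeasure_apply (hφ : Measurable φ) (n : ℕ) (μ : Measure (Space A))
    {E : Set (Space A)} (hE : MeasurableSet E) :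
    gibbsMeasure φ n μ E = ∫⁻ x, gibbsKernel φ n (E.indicator 1) x ∂μ := by
  rw [← lintegral_gibbsMeasure hφ n μ (measurable_one.indicator hE), lintegral_indicator_one hE]

lemma isGibbs_iff (hφ : Measurable φ) (n : ℕ) (μ : Measure (Space A)) :
    IsGibbs φ n μ ↔ μ = gibbsMeasure φ n μ := by
  constructor
  · intro h
    ext E hE
    rw [gibbsMeasure_apply hφ n μ hE, ← h _ (measurable_one.indicator hE),
      lintegral_indicator_one hE]
  · intro h f hf
    rw [← lintegral_gibbsMeasure hφ n μ hf, ← h]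

lemma gibbsKernel_mul_comp_shift (n : ℕ) (g f : Space A → ℝ≥0∞) (x : Space A) :
    gibbsKernel φ n (fun y => g (shift^[n] y) * f y) x =
      g (shift^[n] x) * gibbsKernel φ n f x := by
  unfold gibbsKernel
  rw [transfer_comp_shift_mul, mul_div_assoc]

lemma mem_cyl_iff_eq_concatSeq {w : List ℕ} {y z : Space A} :
    (y ∈ cyl A w ∧ shift^[w.length] y = z) ↔ y.1 = concatSeq w z.1 := by
  constructor
  · rintro ⟨h1, rfl⟩
    ext i
    unfold concatSeq
    split_ifs with hi
    · exact h1 ⟨i, hi⟩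
    · rw [shift_iterate_apply, Nat.sub_add_cancel (by omega)]
  · intro h
    constructor
    · intro i
      rw [h]
      simp [concatSeq]
    · ext i
      rw [shift_iterate_apply, h]
      simp [concatSeq]

lemma isClopen_cyl (w : List ℕ) : IsClopen (cyl A w) := by
  have : cyl A w = ⋂ i : Fin w.length, {x : Space A | x.1 i = w.get i} := by
    ext x; simp [cyl]
  rw [this]
  exact isClopen_iInter_of_finite fun i =>
    (isClopen_discrete {w.get i}).preimage (continuous_coord (A := A) i)

lemma measurableSet_cyl (w : List ℕ) : MeasurableSet (cyl A w) :=
  (isClopen_cyl w).isOpen.measurableSet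

lemma dlrNum_eq (w : List ℕ) (x : Space A) :
    dlrNum A φ w x =
      (transfer φ w.length ((cyl A w).indicator 1) (shift^[w.length] x)).toReal := by
  classical
  unfold dlrNum transfer
  split_ifs with h
  · rw [tsum_eq_single ⟨_, h⟩]
    · have := (mem_cyl_iff_eq_concatSeq (A := A) (w := w) (y := ⟨_, h⟩)
        (z := shift^[w.length] x)).2 rfl
      rw [if_pos this.2, Set.indicator_of_mem this.1]
      simp [weight, (Real.exp_pos _).le]
    · intro y hy
      by_cases h1 : shift^[w.length] y = shift^[w.length] x
      · rw [if_pos h1, Set.indicator_of_notMem, mul_zero]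
        exact fun h2 => hy (Subtype.ext (mem_cyl_iff_eq_concatSeq.1 ⟨h2, h1⟩))
      · rw [if_neg h1]
  · symm
    rw [ENNReal.tsum_eq_zero.2, ENNReal.toReal_zero]
    intro y
    by_cases h1 : shift^[w.length] y = shift^[w.length] x
    · rw [if_pos h1, Set.indicator_of_notMem, mul_zero]
      intro h2
      apply h
      rw [← mem_cyl_iff_eq_concatSeq.1 ⟨h2, h1⟩]
      exact y.2
    · rw [if_neg h1]

lemma dlrDen_eq (n : ℕ) (x : Space A) :
    dlrDen A φ n x = (transfer φ n 1 (shift^[n] x)).toReal := by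
  unfold dlrDen
  rw [transfer_eq_tsum_subtype, ENNReal.tsum_toReal_eq]
  · refine tsum_congr fun y => ?_
    simp [weight, (Real.exp_pos _).le]
  · intro y
    simpa using weight_ne_top n y.1

lemma dlrNum_div_dlrDen (w : List ℕ) (x : Space A) :
    dlrNum A φ w x / dlrDen A φ w.length x =
      (gibbsKernel φ w.length ((cyl A w).indicator 1) x).toReal := by
  rw [dlrNum_eq, dlrDen_eq, gibbsKernel, ENNReal.toReal_div]

lemma shiftSigma_le (n : ℕ) : shiftSigma A n ≤ (inferInstance : MeasurableSpace (Space A)) :=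
  (measurable_shift_iterate n).comap_le

lemma gibbsKernel_le_one {n : ℕ} {f : Space A → ℝ≥0∞} (hf : ∀ y, f y ≤ 1) (x : Space A) :
    gibbsKernel φ n f x ≤ 1 :=
  ENNReal.div_le_of_le_mul (by rw [one_mul]; exact transfer_mono n hf _)

lemma indicator_one_le_one (E : Set (Space A)) (y : Space A) :
    E.indicator (1 : Space A → ℝ≥0∞) y ≤ 1 :=
  Set.indicator_apply_le' (fun _ => le_rfl) fun _ => zero_le

lemma indicator_inter_preimage (n : ℕ) (E B : Set (Space A)) :
    (E ∩ shift^[n] ⁻¹' B).indicator (1 : Space A → ℝ≥0∞) =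
      fun y => B.indicator 1 (shift^[n] y) * E.indicator 1 y := by
  ext y
  by_cases h1 : y ∈ E <;> by_cases h2 : shift^[n] y ∈ B <;> simp [Set.indicator, h1, h2]

lemma gibbsMeasure_inter_preimage (hφ : Measurable φ) (n : ℕ) (μ : Measure (Space A))
    {E B : Set (Space A)} (hE : MeasurableSet E) (hB : MeasurableSet B) :
    gibbsMeasure φ n μ (E ∩ shift^[n] ⁻¹' B) =
      ∫⁻ x in shift^[n] ⁻¹' B, gibbsKernel φ n (E.indicator 1) x ∂μ := by
  have hB' := measurable_shift_iterate (A := A) n hB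
  rw [gibbsMeasure_apply hφ n μ (hE.inter hB'), indicator_inter_preimage,
    ← lintegral_indicator hB']
  refine lintegral_congr fun x => ?_
  rw [gibbsKernel_mul_comp_shift]
  by_cases h : shift^[n] x ∈ B <;> simp [Set.indicator, h]

lemma isClosed_isAdm (A : ℕ → ℕ → Bool) : IsClosed {u : ℕ → ℕ | IsAdm A u} := by
  have : {u : ℕ → ℕ | IsAdm A u} = ⋂ i : ℕ, (fun u : ℕ → ℕ => (u i, u (i + 1))) ⁻¹'
      {p : ℕ × ℕ | A p.1 p.2 = true} := by
    ext u; simp [IsAdm]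
  rw [this]
  exact isClosed_iInter fun i =>
    (isClosed_discrete _).preimage ((continuous_apply i).prodMk (continuous_apply (i + 1)))

instance : PolishSpace (Space A) := (isClosed_isAdm A).polishSpace

/-- A measure is determined by its values on the sets `[w] ∩ σ^{-n} B` with `w` of length `n`. -/
lemma measure_ext_of_cyl_inter {n : ℕ} {μ ν : Measure (Space A)}
    (h : ∀ w : List ℕ, w.length = n → ∀ B : Set (Space A), MeasurableSet B →
      μ (cyl A w ∩ shift^[n] ⁻¹' B) = ν (cyl A w ∩ shift^[n] ⁻¹' B)) : μ = ν := by
  have hinj : ∀ w : List ℕ, w.length = n →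
      Set.InjOn (shift^[n] : Space A → Space A) (cyl A w) := by
    rintro w rfl x hx y hy hxy
    exact eq_of_prefix_of_shift_iterate
      (fun i hi => (hx ⟨i, hi⟩).trans (hy ⟨i, hi⟩).symm) hxy
  ext E hE
  let B : {w : List ℕ // w.length = n} → Set (Space A) := fun w => shift^[n] '' (E ∩ cyl A w.1)
  have hB : ∀ w, MeasurableSet (B w) := fun w =>
    (hE.inter (measurableSet_cyl w.1)).image_of_measurable_injOn (measurable_shift_iterate n)
      ((hinj w.1 w.2).mono Set.inter_subset_right)
  have hpiece : ∀ w : {w : List ℕ // w.length = n},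
      cyl A w.1 ∩ shift^[n] ⁻¹' (B w) = E ∩ cyl A w.1 := by
    intro w
    ext x
    constructor
    · rintro ⟨hx, y, ⟨hyE, hy⟩, hxy⟩
      rw [← hinj w.1 w.2 hy hx hxy]
      exact ⟨hyE, hy⟩
    · exact fun hx => ⟨hx.2, x, hx, rfl⟩
  have hunion : E = ⋃ w : {w : List ℕ // w.length = n}, cyl A w.1 ∩ shift^[n] ⁻¹' (B w) := by
    simp_rw [hpiece]
    rw [← Set.inter_iUnion]
    refine (Set.inter_eq_left.2 fun x _ => Set.mem_iUnion.2 ?_).symm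
    refine ⟨⟨List.ofFn fun i : Fin n => x.1 i, List.length_ofFn⟩, fun i => ?_⟩
    simp
  have hdisj : Pairwise (Function.onFun Disjoint fun w : {w : List ℕ // w.length = n} =>
      cyl A w.1 ∩ shift^[n] ⁻¹' (B w)) := by
    intro v w hvw
    refine Set.disjoint_left.2 fun x hx hx' => hvw (Subtype.ext ?_)
    refine List.ext_get (v.2.trans w.2.symm) fun i h1 h2 => ?_
    exact (hx.1 ⟨i, h1⟩).symm.trans (hx'.1 ⟨i, h2⟩)
  have hmeas : ∀ w : {w : List ℕ // w.length = n},
      MeasurableSet (cyl A w.1 ∩ shift^[n] ⁻¹' (B w)) := fun w =>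
    (measurableSet_cyl w.1).inter (measurable_shift_iterate n (hB w))
  rw [hunion, measure_iUnion hdisj hmeas, measure_iUnion hdisj hmeas]
  exact tsum_congr fun w => h w.1 w.2 _ (hB w)

lemma integral_gibbsKernel_toReal (hφ : Measurable φ) (n : ℕ) (μ : Measure (Space A))
    {E : Set (Space A)} (hE : MeasurableSet E) (s : Set (Space A)) :
    ∫ x in s, (gibbsKernel φ n (E.indicator 1) x).toReal ∂μ =
      (∫⁻ x in s, gibbsKernel φ n (E.indicator 1) x ∂μ).toReal :=
  integral_toReal (measurable_gibbsKernel hφ n (measurable_one.indicator hE)).aemeasurable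
    (Eventually.of_forall fun x =>
      (gibbsKernel_le_one (indicator_one_le_one E) x).trans_lt ENNReal.one_lt_top)

lemma isGibbs_of_isDLR (hφ : Measurable φ) {μ : Measure (Space A)} [IsProbabilityMeasure μ]
    (h : IsDLR A φ μ) {n : ℕ} (hn : 1 ≤ n) : IsGibbs φ n μ := by
  rw [isGibbs_iff hφ]
  refine measure_ext_of_cyl_inter (n := n) fun w hw B hB => ?_
  have hc := (h n hn).2 w hw
  subst hw
  rw [gibbsMeasure_inter_preimage hφ _ μ (measurableSet_cyl w) hB]
  have hB' : MeasurableSet[shiftSigma A w.length] (shift^[w.length] ⁻¹' B) := ⟨B, hB, rfl⟩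
  have hint : Integrable ((cyl A w).indicator fun _ => (1 : ℝ)) μ :=
    (integrable_const (1 : ℝ)).indicator (measurableSet_cyl w)
  have h1 := setIntegral_condExp (shiftSigma_le w.length) hint hB'
  rw [integral_congr_ae (ae_restrict_of_ae hc)] at h1
  simp_rw [dlrNum_div_dlrDen] at h1
  rw [integral_gibbsKernel_toReal hφ _ μ (measurableSet_cyl w),
    integral_indicator_const _ (measurableSet_cyl w)] at h1
  simp only [smul_eq_mul, mul_one, Measure.real] at h1
  rw [Measure.restrict_apply (measurableSet_cyl w)] at h1
  refine ((ENNReal.toReal_eq_toReal_iff' ?_ (measure_ne_top _ _)).1 h1).symm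
  refine ne_top_of_le_ne_top (measure_ne_top μ (shift^[w.length] ⁻¹' B)) ?_
  calc _ ≤ ∫⁻ x in shift^[w.length] ⁻¹' B, 1 ∂μ :=
        lintegral_mono fun x => gibbsKernel_le_one (indicator_one_le_one _) x
    _ = _ := by simp

lemma isDLR_of_isGibbs (hφ : Measurable φ) {μ : Measure (Space A)} [IsProbabilityMeasure μ]
    (h : ∀ n, 1 ≤ n → IsGibbs φ n μ) : IsDLR A φ μ := by
  intro n hn
  refine ⟨⟨fun _ => Set.univ, fun _ => MeasurableSet.univ, fun _ => measure_ne_top _ _,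
    Set.iUnion_const _⟩, fun w hw => ?_⟩
  have hG := (isGibbs_iff hφ n μ).1 (h n hn)
  subst hw
  simp_rw [dlrNum_div_dlrDen]
  symm
  have hcyl := measurableSet_cyl (A := A) w
  have hmeas : Measurable[shiftSigma A w.length]
      fun x => (gibbsKernel φ w.length ((cyl A w).indicator 1) x).toReal := by
    have hm : Measurable fun z : Space A => (transfer φ w.length ((cyl A w).indicator 1) z /
        transfer φ w.length 1 z).toReal :=
      ((measurable_transfer hφ _ (measurable_one.indicator hcyl)).div
        (measurable_transfer hφ _ measurable_one)).ennreal_toReal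
    exact hm.comp (comap_measurable _)
  have hbound : Integrable
      (fun x => (gibbsKernel φ w.length ((cyl A w).indicator 1) x).toReal) μ := by
    refine Integrable.of_bound (hmeas.mono (shiftSigma_le _) le_rfl).aestronglyMeasurable 1
      (Eventually.of_forall fun x => ?_)
    rw [Real.norm_of_nonneg ENNReal.toReal_nonneg]
    exact ENNReal.toReal_mono ENNReal.one_ne_top (gibbsKernel_le_one (indicator_one_le_one _) x)
  refine ae_eq_condExp_of_forall_setIntegral_eq (shiftSigma_le w.length)
    ((integrable_const (1 : ℝ)).indicator hcyl) (fun s _ _ => hbound.integrableOn) ?_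
    hmeas.stronglyMeasurable.aestronglyMeasurable
  rintro s ⟨B, hB, rfl⟩ -
  rw [integral_gibbsKernel_toReal hφ _ μ hcyl, integral_indicator_const _ hcyl,
    ← gibbsMeasure_inter_preimage hφ _ μ hcyl hB, ← hG]
  simp [Measure.real, Measure.restrict_apply hcyl]

lemma exists_prefix_subset {U : Set (Space A)} (hU : IsOpen U) {x : Space A} (hx : x ∈ U) :
    ∃ k : ℕ, ∀ y : Space A, (∀ i < k, y.1 i = x.1 i) → y ∈ U := by
  by_contra! h
  choose y hy hyU using h
  have ht : Tendsto y atTop (𝓝 x) := by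
    refine tendsto_subtype_rng.2 (tendsto_pi_nhds.2 fun i => ?_)
    refine tendsto_const_nhds.congr' ?_
    filter_upwards [eventually_gt_atTop i] with k hk
    exact (hy k i hk).symm
  obtain ⟨k, hk⟩ := (ht.eventually (hU.mem_nhds hx)).exists
  exact hyU k hk

/-- Comparison of two measures on sets determined by finitely many coordinates extends to all
Borel sets. -/
lemma smul_le_of_prefix {μ ν : Measure (Space A)} [IsFiniteMeasure ν] {c : ℝ≥0∞}
    (h : ∀ (s : ℕ) (E : Set (Space A)), MeasurableSet E →
      DependsOnPrefix s (E.indicator (1 : Space A → ℝ≥0∞)) → c * μ E ≤ ν E) : c • μ ≤ ν := by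
  have hopen : ∀ U : Set (Space A), IsOpen U → c * μ U ≤ ν U := by
    intro U hU
    let V : ℕ → Set (Space A) := fun k => {x | ∀ y : Space A, (∀ i < k, y.1 i = x.1 i) → y ∈ U}
    have hV : ∀ k, IsOpen (V k) := by
      intro k
      refine isOpen_iff_mem_nhds.2 fun x hx => ?_
      filter_upwards [eventually_prefix_eq k x] with z hz y hy
      exact hx y fun i hi => (hy i hi).trans (hz i hi)
    have hmono : Monotone V := fun k l hkl x hx y hy => hx y fun i hi => hy i (hi.trans_le hkl)
    have hUV : U = ⋃ k, V k := by
      ext x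
      refine ⟨fun hx => Set.mem_iUnion.2 (exists_prefix_subset hU hx), fun hx => ?_⟩
      obtain ⟨k, hk⟩ := Set.mem_iUnion.1 hx
      exact hk x fun _ _ => rfl
    rw [hUV, hmono.measure_iUnion, hmono.measure_iUnion, ENNReal.mul_iSup]
    refine iSup_mono fun k => h k _ (hV k).measurableSet fun x y hxy => ?_
    have : x ∈ V k ↔ y ∈ V k :=
      ⟨fun hx z hz => hx z fun i hi => (hz i hi).trans (hxy i hi).symm,
        fun hy z hz => hy z fun i hi => (hz i hi).trans (hxy i hi)⟩
    by_cases hx : x ∈ V k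
    · rw [Set.indicator_of_mem hx, Set.indicator_of_mem (this.1 hx)]; rfl
    · rw [Set.indicator_of_notMem hx, Set.indicator_of_notMem (fun hy => hx (this.2 hy))]
  refine Measure.le_iff.2 fun E _ => ?_
  rw [Set.measure_eq_iInf_isOpen E ν]
  refine le_iInf₂ fun U hEU => le_iInf fun hU => ?_
  exact (mul_le_mul_right (measure_mono hEU) c).trans (hopen U hU)

namespace UniformBounds

variable {u : ℕ → ℝ≥0∞} {m K : ℝ≥0∞} {q : ℕ}

lemma gibbsKernel_le (h : UniformBounds φ u m K q) {s : ℕ} {f : Space A → ℝ≥0∞}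
    (hf : DependsOnPrefix s f) (x x' : Space A) :
    gibbsKernel φ (q + s) f x' ≤ K * K * gibbsKernel φ (q + s) f x := by
  have h1 : DependsOnPrefix s (1 : Space A → ℝ≥0∞) := fun _ _ _ => rfl
  unfold gibbsKernel
  set z := shift^[q + s] x
  set z' := shift^[q + s] x'
  have h0 := h.transfer_ne_zero (q + s) z
  have ht := h.transfer_ne_top (q + s) z
  refine ENNReal.div_le_of_le_mul ?_
  calc transfer φ (q + s) f z' ≤ K * transfer φ (q + s) f z := h.harnack s f hf z z'
    _ = K * (transfer φ (q + s) f z / transfer φ (q + s) 1 z * transfer φ (q + s) 1 z) := by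
        rw [ENNReal.div_mul_cancel h0 ht]
    _ ≤ K * (transfer φ (q + s) f z / transfer φ (q + s) 1 z *
          (K * transfer φ (q + s) 1 z')) := by
        gcongr
        exact h.harnack s 1 h1 z' z
    _ = _ := by ring

lemma const_ne_zero [Nonempty (Space A)] (h : UniformBounds φ u m K q) : K ≠ 0 := by
  rintro rfl
  obtain ⟨z⟩ := ‹Nonempty (Space A)›
  have := h.harnack 0 1 (fun _ _ _ => rfl) z z
  rw [zero_mul] at this
  exact h.transfer_ne_zero _ z (le_antisymm this zero_le)

lemma smul_le_of_gibbs (h : UniformBounds φ u m K q) {ρ ν : Measure (Space A)}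
    [IsFiniteMeasure ρ] [IsProbabilityMeasure ν]
    (hρ : ∀ n, 1 ≤ n → ∀ E, MeasurableSet E → ρ E = ∫⁻ x, gibbsKernel φ n (E.indicator 1) x ∂ρ)
    (hν : ∀ n, 1 ≤ n → IsGibbs φ n ν) : ((K * K)⁻¹ * ρ Set.univ) • ν ≤ ρ := by
  have : Nonempty (Space A) := ν.nonempty_of_neZero
  have hK0 : K * K ≠ 0 := mul_ne_zero h.const_ne_zero h.const_ne_zero
  have hKt : K * K ≠ ⊤ := ENNReal.mul_ne_top h.const_ne_top h.const_ne_top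
  refine smul_le_of_prefix fun s E hE hs => ?_
  have hs' : DependsOnPrefix (s + 1) (E.indicator (1 : Space A → ℝ≥0∞)) :=
    fun x y hxy => hs x y fun i hi => hxy i (by omega)
  have hpt : ∀ x, (K * K)⁻¹ * ν E ≤ gibbsKernel φ (q + (s + 1)) (E.indicator 1) x := by
    intro x
    rw [mul_comm, ← div_eq_mul_inv]
    refine ENNReal.div_le_of_le_mul ?_
    rw [← lintegral_indicator_one hE, hν (q + (s + 1)) (by omega) _ (measurable_one.indicator hE)]
    calc _ ≤ ∫⁻ _, K * K * gibbsKernel φ (q + (s + 1)) (E.indicator 1) x ∂ν :=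
          lintegral_mono fun x' => h.gibbsKernel_le hs' x x'
      _ = _ := by rw [lintegral_const, measure_univ, mul_one, mul_comm]
  rw [hρ (q + (s + 1)) (by omega) E hE]
  calc _ = ∫⁻ _, (K * K)⁻¹ * ν E ∂ρ := by rw [lintegral_const]; ring
    _ ≤ _ := lintegral_mono hpt

/-- There is at most one probability measure invariant under all the normalised kernels. -/
lemma gibbs_unique (h : UniformBounds φ u m K q) {μ ν : Measure (Space A)}
    [IsProbabilityMeasure μ] [IsProbabilityMeasure ν] (hμ : ∀ n, 1 ≤ n → IsGibbs φ n μ)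
    (hν : ∀ n, 1 ≤ n → IsGibbs φ n ν) : μ = ν := by
  have hKt : K * K ≠ ⊤ := ENNReal.mul_ne_top h.const_ne_top h.const_ne_top
  set κ : ℝ≥0∞ := sSup {c : ℝ≥0∞ | c • ν ≤ μ} with hκ
  have hle : κ • ν ≤ μ := by
    refine Measure.le_iff.2 fun E _ => ?_
    rw [Measure.smul_apply, smul_eq_mul, hκ, ENNReal.sSup_mul]
    exact iSup₂_le fun c hc => hc E
  have hκ1 : κ ≤ 1 := by simpa using hle Set.univ
  have hκt : κ ≠ ⊤ := ne_top_of_le_ne_top ENNReal.one_ne_top hκ1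
  have : IsFiniteMeasure (κ • ν) := ⟨by simpa using hκt.lt_top⟩
  set ρ := μ - κ • ν with hρ
  have hadd : ρ + κ • ν = μ := Measure.sub_add_cancel_of_le hle
  have hρfin : IsFiniteMeasure ρ := ⟨(Measure.sub_le _).trans_lt (measure_lt_top μ _)⟩
  have hgibbs : ∀ n, 1 ≤ n → ∀ E, MeasurableSet E →
      ρ E = ∫⁻ x, gibbsKernel φ n (E.indicator 1) x ∂ρ := by
    intro n hn E hE
    have h1 := hμ n hn _ (measurable_one.indicator hE)
    have h2 := hν n hn _ (measurable_one.indicator hE)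
    rw [← hadd, lintegral_add_measure, lintegral_add_measure, lintegral_smul_measure,
      lintegral_smul_measure, ← h2, lintegral_indicator_one hE, lintegral_indicator_one hE] at h1
    refine (ENNReal.add_left_inj ?_).1 h1
    exact ENNReal.mul_ne_top hκt (measure_ne_top _ _)
  have hlow := h.smul_le_of_gibbs hgibbs hν
  have hmem : (K * K)⁻¹ * ρ Set.univ + κ ≤ κ := by
    refine le_sSup ?_
    change _ • ν ≤ μ
    rw [add_smul]
    calc _ ≤ ρ + κ • ν := by gcongr
      _ = μ := hadd
  have hzero : ρ Set.univ = 0 := by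
    have : (K * K)⁻¹ * ρ Set.univ = 0 := by
      have h3 : (K * K)⁻¹ * ρ Set.univ + κ ≤ 0 + κ := by rwa [zero_add]
      exact le_antisymm ((ENNReal.add_le_add_iff_right hκt).1 h3) zero_le
    exact (mul_eq_zero.1 this).resolve_left (ENNReal.inv_ne_zero.2 hKt)
  rw [Measure.measure_univ_eq_zero] at hzero
  rw [hzero, zero_add] at hadd
  have h1 : κ = 1 := by
    have := congrArg (fun ξ : Measure (Space A) => ξ Set.univ) hadd
    simpa using this
  rw [← hadd, h1, one_smul]

end UniformBounds

lemma dual_iterate_of_eq_smul {c : ℝ≥0∞} {μ : Measure (Space A)} (h : μ = c • dual φ μ) (n : ℕ) :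
    μ = c ^ n • (dual φ)^[n] μ := by
  induction n with
  | zero => simp
  | succ n ih =>
    rw [Function.iterate_succ_apply', pow_succ', mul_smul, ← dual_smul, ← ih, ← h]

lemma lintegral_eq_transfer_of_eq_smul (hφ : Measurable φ) {c : ℝ≥0∞} {μ : Measure (Space A)}
    (h : μ = c • dual φ μ) (n : ℕ) {f : Space A → ℝ≥0∞} (hf : Measurable f) :
    ∫⁻ x, f x ∂μ = c ^ n * ∫⁻ x, transfer φ n f x ∂μ := by
  conv_lhs => rw [dual_iterate_of_eq_smul h n]
  rw [lintegral_smul_measure, lintegral_dual_iterate hφ n μ hf, smul_eq_mul]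

namespace UniformBounds

variable {u : ℕ → ℝ≥0∞} {m K : ℝ≥0∞} {q : ℕ}

lemma transfer_gibbsKernel (h : UniformBounds φ u m K q) (n : ℕ) (f : Space A → ℝ≥0∞) :
    transfer φ n (gibbsKernel φ n f) = transfer φ n f := by
  ext z
  have := transfer_comp_shift_mul (φ := φ) n (fun z => transfer φ n f z / transfer φ n 1 z) 1 z
  simp only [Pi.one_apply, mul_one] at this
  rw [ENNReal.div_mul_cancel (h.transfer_ne_zero n z) (h.transfer_ne_top n z)] at this
  exact this

lemma isGibbs_of_eq_smul (h : UniformBounds φ u m K q) (hφ : Measurable φ) {c : ℝ≥0∞}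
    {μ : Measure (Space A)} (hμ : μ = c • dual φ μ) (n : ℕ) : IsGibbs φ n μ := by
  intro f hf
  rw [lintegral_eq_transfer_of_eq_smul hφ hμ n hf,
    lintegral_eq_transfer_of_eq_smul hφ hμ n (measurable_gibbsKernel hφ n hf),
    h.transfer_gibbsKernel]

lemma isGibbs_dual (h : UniformBounds φ u m K q) (hφ : Measurable φ) {n : ℕ}
    {μ : Measure (Space A)} (hμ : IsGibbs φ n μ) : IsGibbs φ (n + 1) (dual φ μ) := by
  intro f hf
  have hg := measurable_gibbsKernel hφ (n + 1) hf
  rw [lintegral_dual hφ μ hf, lintegral_dual hφ μ hg,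
    hμ _ (measurable_transfer hφ 1 hf), hμ _ (measurable_transfer hφ 1 hg)]
  refine lintegral_congr fun x => ?_
  unfold gibbsKernel
  rw [← transfer_add, ← transfer_add]
  congr 1
  exact (congrFun (h.transfer_gibbsKernel (n + 1) f) _).symm

end UniformBounds

lemma IsGibbs.smul {n : ℕ} {μ : Measure (Space A)} (h : IsGibbs φ n μ) (c : ℝ≥0∞) :
    IsGibbs φ n (c • μ) := by
  intro f hf
  rw [lintegral_smul_measure, lintegral_smul_measure, h f hf]

lemma isGibbs_zero (μ : Measure (Space A)) : IsGibbs φ 0 μ := by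
  intro f _
  refine lintegral_congr fun x => ?_
  simp [gibbsKernel, transfer_zero]

namespace UniformBounds

variable {u : ℕ → ℝ≥0∞} {m K : ℝ≥0∞} {q : ℕ}

lemma exists_conformal (h : UniformBounds φ u m K q) (hφ : Measurable φ) {μ : Measure (Space A)}
    [IsProbabilityMeasure μ] (hμ : ∀ n, 1 ≤ n → IsGibbs φ n μ) :
    ∃ l : ℝ, 0 < l ∧ Conformal A φ l μ := by
  set c := dual φ μ Set.univ with hc
  have hcint : c = ∫⁻ x, transfer φ 1 1 x ∂μ := by
    rw [hc, dual_apply hφ μ MeasurableSet.univ, Set.indicator_univ]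
  have hc0 : c ≠ 0 := by
    intro h0
    refine h.lower_ne_zero (le_antisymm ?_ zero_le)
    rw [← h0, hcint]
    calc m = ∫⁻ _, m ∂μ := by simp
      _ ≤ _ := lintegral_mono h.lower_le
  have hct : c ≠ ⊤ := by
    refine ne_top_of_le_ne_top h.tsum_ne_top ?_
    rw [hcint]
    calc _ ≤ ∫⁻ _, ∑' a, u a ∂μ := lintegral_mono (transfer_one_one_le h.exp_le)
      _ = _ := by simp
  have hprob : IsProbabilityMeasure (c⁻¹ • dual φ μ) :=
    ⟨by rw [Measure.smul_apply, smul_eq_mul, ← hc, ENNReal.inv_mul_cancel hc0 hct]⟩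
  have hgibbs : ∀ n, 1 ≤ n → IsGibbs φ n (c⁻¹ • dual φ μ) := by
    intro n hn
    obtain ⟨k, rfl⟩ := Nat.exists_eq_add_of_le' hn
    refine (h.isGibbs_dual hφ ?_).smul _
    rcases Nat.eq_zero_or_pos k with rfl | hk
    · exact isGibbs_zero μ
    · exact hμ k hk
  have heq := h.gibbs_unique hμ hgibbs
  have hl : 0 < c.toReal := ENNReal.toReal_pos hc0 hct
  refine ⟨c.toReal, hl, (conformal_iff _ hl μ).2 ?_⟩
  rwa [ENNReal.ofReal_inv_of_pos hl, ENNReal.ofReal_toReal hct]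

lemma map_shift_apply_of_eq_smul (hφ : Measurable φ) {c : ℝ≥0∞}
    {μ : Measure (Space A)} (hμ : μ = c • dual φ μ) {B : Set (Space A)} (hB : MeasurableSet B) :
    μ.map shift B = c * ∫⁻ x in B, transfer φ 1 1 x ∂μ := by
  have hs : Measurable (shift : Space A → Space A) := continuous_shift.measurable
  rw [Measure.map_apply hs hB, ← lintegral_indicator_one (hs hB),
    lintegral_eq_transfer_of_eq_smul hφ hμ 1 (measurable_one.indicator (hs hB)), pow_one,
    ← lintegral_indicator hB]
  congr 1
  refine lintegral_congr fun x => ?_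
  have := transfer_comp_shift_mul (φ := φ) 1 (B.indicator 1) 1 x
  simp only [Pi.one_apply, mul_one, Function.iterate_one] at this
  calc transfer φ 1 ((shift ⁻¹' B).indicator 1) x
      = transfer φ 1 (fun y => B.indicator 1 (shift y)) x := rfl
    _ = B.indicator 1 x * transfer φ 1 1 x := this
    _ = B.indicator (transfer φ 1 1) x := by by_cases hx : x ∈ B <;> simp [hx]

lemma nonSingular (h : UniformBounds φ u m K q) (hφ : Measurable φ) {c : ℝ≥0∞} (hc : c ≠ 0)
    {μ : Measure (Space A)} (hμ : μ = c • dual φ μ) : NonSingular A μ := by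
  constructor
  · refine Measure.AbsolutelyContinuous.mk fun B hB h0 => ?_
    rw [map_shift_apply_of_eq_smul hφ hμ hB, setLIntegral_measure_zero _ _ h0, mul_zero]
  · refine Measure.AbsolutelyContinuous.mk fun B hB h0 => ?_
    rw [map_shift_apply_of_eq_smul hφ hμ hB, mul_eq_zero] at h0
    have h1 : m * μ B ≤ 0 := by
      rw [← h0.resolve_left hc]
      calc m * μ B = ∫⁻ _ in B, m ∂μ := by simp
        _ ≤ _ := lintegral_mono h.lower_le
    exact (mul_eq_zero.1 (le_antisymm h1 zero_le)).resolve_left h.lower_ne_zero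

end UniformBounds

namespace UniformBounds

variable {u : ℕ → ℝ≥0∞} {m K : ℝ≥0∞} {q : ℕ}

lemma continuous_transfer_one (h : UniformBounds φ u m K q) (hφ : Continuous φ)
    {f : Space A → ℝ≥0∞} (hf : Continuous f) {C : ℝ≥0∞} (hC : C ≠ ⊤) (hfC : ∀ x, f x ≤ C) :
    Continuous (transfer φ 1 f) := by
  refine continuous_iff_continuousAt.2 fun z => ?_
  have heq : transfer φ 1 f = fun z => ∫⁻ a : ℕ, if A a (z.1 0) = true then
      ENNReal.ofReal (Real.exp (φ (prep A a z))) * f (prep A a z) else 0 ∂Measure.count := by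
    ext z
    rw [transfer_one, lintegral_count]
  rw [heq]
  refine tendsto_lintegral_filter_of_dominated_convergence (fun a => u a * C)
    (Eventually.of_forall fun _ => measurable_from_top)
    (Eventually.of_forall fun y => Eventually.of_forall fun a => ?_) ?_
    (Eventually.of_forall fun a => ?_)
  · split_ifs with ha
    · have := h.exp_le (prep A a y)
      rw [prep_apply_zero ha] at this
      exact mul_le_mul' this (hfC _)
    · exact zero_le
  · rw [lintegral_count, ENNReal.tsum_mul_right]
    exact ENNReal.mul_ne_top h.tsum_ne_top hC
  · have hz := eventually_prefix_eq 1 z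
    by_cases ha : A a (z.1 0) = true
    · rw [if_pos ha]
      have hc : Continuous fun y =>
          ENNReal.ofReal (Real.exp (φ (prep A a y))) * f (prep A a y) := by
        refine Continuous.ennreal_mul ?_ (hf.comp (continuous_prep a))
          (fun x => Or.inr (ne_top_of_le_ne_top hC (hfC _)))
          (fun x => Or.inr ENNReal.ofReal_ne_top)
        exact ENNReal.continuous_ofReal.comp
          (Real.continuous_exp.comp (hφ.comp (continuous_prep a)))
      refine (hc.tendsto z).congr' ?_
      filter_upwards [hz] with y hy
      rw [hy 0 one_pos, if_pos ha]
    · rw [if_neg ha]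
      refine tendsto_const_nhds.congr' ?_
      filter_upwards [hz] with y hy
      rw [hy 0 one_pos, if_neg ha]

lemma transfer_le_of_le (h : UniformBounds φ u m K q) (n : ℕ) {f : Space A → ℝ≥0∞} {C : ℝ≥0∞}
    (hfC : ∀ x, f x ≤ C) (z : Space A) : transfer φ n f z ≤ C * (∑' a, u a) ^ n := by
  refine (transfer_mono n hfC z).trans ?_
  rw [transfer_const]
  gcongr
  exact transfer_le_pow_mul h.exp_le n z

lemma continuous_transfer (h : UniformBounds φ u m K q) (hφ : Continuous φ) (n : ℕ)
    {f : Space A → ℝ≥0∞} (hf : Continuous f) {C : ℝ≥0∞} (hC : C ≠ ⊤) (hfC : ∀ x, f x ≤ C) :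
    Continuous (transfer φ n f) := by
  induction n with
  | zero => rwa [transfer_zero]
  | succ n ih =>
    rw [add_comm, transfer_add]
    exact h.continuous_transfer_one hφ ih
      (ENNReal.mul_ne_top hC (ENNReal.pow_ne_top h.tsum_ne_top)) (h.transfer_le_of_le n hfC)

lemma continuous_gibbsKernel (h : UniformBounds φ u m K q) (hφ : Continuous φ) (n : ℕ)
    {f : Space A → ℝ≥0∞} (hf : Continuous f) {C : ℝ≥0∞} (hC : C ≠ ⊤) (hfC : ∀ x, f x ≤ C) :
    Continuous (gibbsKernel φ n f) := by
  have h1 := h.continuous_transfer hφ n hf hC hfC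
  have h2 := h.continuous_transfer hφ n (f := 1) continuous_one ENNReal.one_ne_top fun _ => le_rfl
  have h3 : Continuous fun z => transfer φ n f z / transfer φ n 1 z :=
    continuous_iff_continuousAt.2 fun z => ENNReal.Tendsto.div (h1.tendsto z)
      (Or.inr (h.transfer_ne_zero n z)) (h2.tendsto z) (Or.inl (h.transfer_ne_top n z))
  exact h3.comp (continuous_shift.iterate n)

lemma gibbsKernel_le_of_le {n : ℕ} {f : Space A → ℝ≥0∞} {C : ℝ≥0∞} (hf : ∀ y, f y ≤ C)
    (x : Space A) : gibbsKernel φ n f x ≤ C := by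
  refine ENNReal.div_le_of_le_mul ((transfer_mono n hf _).trans ?_)
  rw [transfer_const]

lemma gibbsKernel_gibbsKernel (h : UniformBounds φ u m K q) {n N : ℕ} (hnN : n ≤ N)
    (f : Space A → ℝ≥0∞) : gibbsKernel φ N (gibbsKernel φ n f) = gibbsKernel φ N f := by
  obtain ⟨k, rfl⟩ := Nat.exists_eq_add_of_le' hnN
  ext x
  unfold gibbsKernel
  congr 1
  rw [transfer_add, transfer_add]
  exact congrFun (congrArg (transfer φ k) (h.transfer_gibbsKernel n f)) _

/-- Uniform tail estimate for the `i`-th coordinate under the normalised kernels. -/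
lemma gibbsKernel_tail_le (h : UniformBounds φ u m K q) {i N : ℕ} (hi : i < N) (g : ℕ → ℝ≥0∞)
    (x : Space A) : gibbsKernel φ N (fun y => g (y.1 i)) x ≤
      (∑' a, u a) ^ i / m ^ (i + 1) * ∑' a, u a * g a := by
  obtain ⟨k, rfl⟩ := Nat.exists_eq_add_of_le' hi
  have hm0 := h.lower_ne_zero
  have hmt : m ≠ ⊤ := ne_top_of_le_ne_top (h.transfer_ne_top 1 x) (h.lower_le x)
  set S := ∑' a, u a
  set T := ∑' a, u a * g a
  set z := shift^[k + (i + 1)] x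
  have hnum : transfer φ (k + (i + 1)) (fun y => g (y.1 i)) z ≤ S ^ i * T * transfer φ k 1 z := by
    rw [transfer_add]
    refine (transfer_mono k (g := fun _ => S ^ i * T) (fun w => ?_) z).trans ?_
    · rw [add_comm i 1, transfer_add]
      have h1 : transfer φ i (fun y : Space A => g (y.1 i)) =
          fun y => g (y.1 0) * transfer φ i 1 y := by
        ext y
        have := transfer_comp_shift_mul (φ := φ) i (fun y => g (y.1 0)) 1 y
        simpa [shift_iterate_apply] using this
      rw [h1]
      refine (transfer_mono 1 (g := fun y => S ^ i * g (y.1 0)) (fun y => ?_) w).trans ?_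
      · rw [mul_comm]
        gcongr
        exact transfer_le_pow_mul h.exp_le i y
      · rw [transfer_const_mul]
        gcongr
        exact transfer_one_le_tsum h.exp_le g w
    · rw [transfer_const]
  have hden : m ^ (i + 1) * transfer φ k 1 z ≤ transfer φ (k + (i + 1)) 1 z := by
    rw [transfer_add, ← transfer_const]
    exact transfer_mono k (h.pow_le_transfer (i + 1)) z
  refine ENNReal.div_le_of_le_mul (hnum.trans ?_)
  calc S ^ i * T * transfer φ k 1 z
      = S ^ i / m ^ (i + 1) * T * (m ^ (i + 1) * transfer φ k 1 z) := by
        rw [div_eq_mul_inv]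
        have := ENNReal.inv_mul_cancel (pow_ne_zero (i + 1) hm0)
          (ENNReal.pow_ne_top hmt (n := i + 1))
        calc _ = S ^ i * ((m ^ (i + 1))⁻¹ * m ^ (i + 1)) * T * transfer φ k 1 z := by
              rw [this, mul_one]
          _ = _ := by ring
    _ ≤ _ := by gcongr

lemma gibbsKernel_tail_of_le {i N : ℕ} (hi : N ≤ i) {g : ℕ → ℝ≥0∞}
    {x : Space A} (hx : g (x.1 i) = 0) : gibbsKernel φ N (fun y => g (y.1 i)) x = 0 := by
  have := gibbsKernel_mul_comp_shift (φ := φ) N (fun y => g (y.1 (i - N))) 1 x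
  simpa [shift_iterate_apply, Nat.sub_add_cancel hi, hx] using this

lemma exists_tail_le (h : UniformBounds φ u m K q) (x : Space A) (i : ℕ) {ε : ℝ≥0∞}
    (hε : ε ≠ 0) : ∃ M : ℕ, ∀ N, gibbsKernel φ N
      ({y : Space A | M < y.1 i}.indicator 1) x ≤ ε := by
  have hm0 := h.lower_ne_zero
  set c := (∑' a, u a) ^ i / m ^ (i + 1)
  have hc : c ≠ ⊤ := ENNReal.div_ne_top (ENNReal.pow_ne_top h.tsum_ne_top) (pow_ne_zero _ hm0)
  have hlim : Tendsto (fun M : ℕ => ∑' a, u a * (if M < a then 1 else 0)) atTop (𝓝 0) := by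
    have := tendsto_lintegral_filter_of_dominated_convergence (μ := (Measure.count : Measure ℕ))
      (l := atTop) (F := fun M a => u a * (if M < a then 1 else 0)) (f := fun _ => 0) u
      (Eventually.of_forall fun _ => measurable_from_top)
      (Eventually.of_forall fun M => Eventually.of_forall fun a => by
        split_ifs <;> simp)
      (by rw [lintegral_count]; exact h.tsum_ne_top)
      (Eventually.of_forall fun a => by
        refine tendsto_const_nhds.congr' ?_
        filter_upwards [eventually_ge_atTop a] with M hM
        rw [if_neg (by omega), mul_zero])
    simpa [lintegral_count] using this
  have hlim' := ENNReal.Tendsto.const_mul (a := c) hlim (Or.inr hc)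
  rw [mul_zero] at hlim'
  obtain ⟨M, hM, hMx⟩ := ((hlim'.eventually (gt_mem_nhds (pos_iff_ne_zero.2 hε))).and
    (eventually_ge_atTop (x.1 i))).exists
  refine ⟨M, fun N => ?_⟩
  have heq : ({y : Space A | M < y.1 i}.indicator 1 : Space A → ℝ≥0∞) =
      fun y => (fun a : ℕ => if M < a then (1 : ℝ≥0∞) else 0) (y.1 i) := by
    ext y; simp [Set.indicator]
  rw [heq]
  rcases lt_or_ge i N with hi | hi
  · exact (h.gibbsKernel_tail_le hi _ x).trans hM.le
  · refine (gibbsKernel_tail_of_le hi (g := fun a : ℕ => if M < a then (1 : ℝ≥0∞) else 0)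
      (if_neg (by omega))).le.trans zero_le

end UniformBounds

lemma isCompact_setOf_le (M : ℕ → ℕ) : IsCompact {y : Space A | ∀ i, y.1 i ≤ M i} := by
  have h1 : IsCompact (Set.univ.pi fun i => Set.Iic (M i)) :=
    isCompact_univ_pi fun i => (Set.finite_Iic (M i)).isCompact
  have h2 := (isClosed_isAdm A).isClosedEmbedding_subtypeVal.isCompact_preimage h1
  have h3 : {y : Space A | ∀ i, y.1 i ≤ M i} =
      Subtype.val ⁻¹' (Set.univ.pi fun i => Set.Iic (M i)) := by
    ext y
    simp [Pi.le_def]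
  rw [h3]
  exact h2

namespace UniformBounds

variable {u : ℕ → ℝ≥0∞} {m K : ℝ≥0∞} {q : ℕ}

lemma isProbabilityMeasure_gibbsMeasure (h : UniformBounds φ u m K q) (hφ : Measurable φ) (n : ℕ)
    (μ : Measure (Space A)) [IsProbabilityMeasure μ] :
    IsProbabilityMeasure (gibbsMeasure φ n μ) := by
  constructor
  rw [gibbsMeasure_apply hφ n μ MeasurableSet.univ, Set.indicator_univ]
  have : ∀ x, gibbsKernel φ n 1 x = 1 := fun x =>
    ENNReal.div_self (h.transfer_ne_zero n _) (h.transfer_ne_top n _)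
  simp [this]

lemma lintegral_gibbsMeasure_dirac (hφ : Measurable φ) (n : ℕ) (x : Space A)
    {f : Space A → ℝ≥0∞} (hf : Measurable f) :
    ∫⁻ y, f y ∂(gibbsMeasure φ n (Measure.dirac x)) = gibbsKernel φ n f x := by
  rw [lintegral_gibbsMeasure hφ n _ hf, lintegral_dirac' _ (measurable_gibbsKernel hφ n hf)]

lemma isTightMeasureSet_gibbsMeasure (h : UniformBounds φ u m K q) (hφ : Measurable φ)
    (x : Space A) :
    IsTightMeasureSet (Set.range fun N => gibbsMeasure φ N (Measure.dirac x)) := by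
  rw [isTightMeasureSet_iff_exists_isCompact_measure_compl_le]
  intro ε hε
  obtain ⟨δ, hδ0, hδ⟩ := ENNReal.exists_pos_sum_of_countable' hε.ne' ℕ
  choose M hM using fun i => h.exists_tail_le x i (hδ0 i).ne'
  refine ⟨_, isCompact_setOf_le M, ?_⟩
  rintro _ ⟨N, rfl⟩
  have hc : {y : Space A | ∀ i, y.1 i ≤ M i}ᶜ = ⋃ i, {y : Space A | M i < y.1 i} := by
    ext y; simp
  rw [hc]
  refine (measure_iUnion_le _).trans ((ENNReal.tsum_le_tsum fun i => ?_).trans hδ.le)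
  have hmeas : MeasurableSet {y : Space A | M i < y.1 i} :=
    ((continuous_coord (A := A) i).isOpen_preimage _ (isOpen_discrete {j | M i < j})).measurableSet
  rw [← lintegral_indicator_one hmeas,
    lintegral_gibbsMeasure_dirac hφ N x (measurable_one.indicator hmeas)]
  exact hM i N

open scoped BoundedContinuousFunction NNReal in
/-- Existence of a probability measure invariant under all the normalised kernels. -/
lemma exists_gibbs [Nonempty (Space A)] (h : UniformBounds φ u m K q) (hφ : Continuous φ) :
    ∃ μ : Measure (Space A), IsProbabilityMeasure μ ∧ ∀ n, IsGibbs φ n μ := by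
  obtain ⟨x⟩ := ‹Nonempty (Space A)›
  have hm := hφ.measurable
  let μ : ℕ → ProbabilityMeasure (Space A) := fun N =>
    ⟨gibbsMeasure φ N (Measure.dirac x), h.isProbabilityMeasure_gibbsMeasure hm N _⟩
  have htight : IsTightMeasureSet {((ν : ProbabilityMeasure (Space A)) : Measure (Space A)) |
      ν ∈ Set.range μ} := by
    have := h.isTightMeasureSet_gibbsMeasure hm x
    convert this using 1
    ext ν
    constructor
    · rintro ⟨_, ⟨N, rfl⟩, rfl⟩
      exact ⟨N, rfl⟩
    · rintro ⟨N, rfl⟩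
      exact ⟨μ N, ⟨N, rfl⟩, rfl⟩
  let U : Ultrafilter ℕ := Ultrafilter.of atTop
  have hU : (U : Filter ℕ) ≤ atTop := Ultrafilter.of_le atTop
  obtain ⟨ν, -, hν⟩ := (isCompact_closure_of_isTightMeasureSet htight).ultrafilter_le_nhds
    (U.map μ) (by
      rw [le_principal_iff]
      exact Filter.mem_of_superset (Filter.range_mem_map) subset_closure)
  have hν' : Tendsto μ U (𝓝 ν) := hν
  rw [ProbabilityMeasure.tendsto_iff_forall_lintegral_tendsto] at hν'
  refine ⟨ν, inferInstance, fun n => (isGibbs_iff hm n _).2 ?_⟩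
  have := h.isProbabilityMeasure_gibbsMeasure hm n (ν : Measure (Space A))
  refine ext_of_forall_lintegral_eq_of_IsFiniteMeasure fun f => ?_
  obtain ⟨C, hC⟩ : ∃ C : ℝ≥0, ∀ y, f y ≤ C := ⟨_, fun y => f.apply_le_nndist_zero y⟩
  have hfC : ∀ y, (f y : ℝ≥0∞) ≤ C := fun y => ENNReal.coe_le_coe.2 (hC y)
  have hfc : Continuous fun y => (f y : ℝ≥0∞) := ENNReal.continuous_coe.comp f.continuous
  have hgc := h.continuous_gibbsKernel hφ n hfc ENNReal.coe_ne_top hfC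
  have hgC : ∀ y, gibbsKernel φ n (fun y => (f y : ℝ≥0∞)) y ≤ C := gibbsKernel_le_of_le hfC
  have hgt : ∀ y, gibbsKernel φ n (fun y => (f y : ℝ≥0∞)) y ≠ ⊤ := fun y =>
    ne_top_of_le_ne_top ENNReal.coe_ne_top (hgC y)
  let g : Space A →ᵇ ℝ≥0 := BoundedContinuousFunction.mkOfBound
    ⟨fun y => (gibbsKernel φ n (fun y => (f y : ℝ≥0∞)) y).toNNReal,
      ENNReal.continuousOn_toNNReal.comp_continuous hgc hgt⟩ C (fun y y' => by
        set b := fun y => (gibbsKernel φ n (fun y => (f y : ℝ≥0∞)) y).toNNReal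
        have hb : ∀ y, (b y : ℝ) ≤ C := fun y =>
          NNReal.coe_le_coe.2 (ENNReal.toNNReal_mono ENNReal.coe_ne_top (hgC y))
        change dist (b y) (b y') ≤ C
        rw [NNReal.dist_eq, abs_sub_le_iff]
        constructor <;> linarith [hb y, hb y', (b y).coe_nonneg, (b y').coe_nonneg])
  have hg : ∀ y, (g y : ℝ≥0∞) = gibbsKernel φ n (fun y => (f y : ℝ≥0∞)) y := fun y =>
    ENNReal.coe_toNNReal (hgt y)
  rw [lintegral_gibbsMeasure hm n _ hfc.measurable]
  simp_rw [← hg]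
  refine tendsto_nhds_unique (hν' f) ((hν' g).congr' ?_)
  filter_upwards [hU (eventually_ge_atTop n)] with N hN
  change ∫⁻ y, (g y : ℝ≥0∞) ∂(gibbsMeasure φ N (Measure.dirac x)) =
    ∫⁻ y, (f y : ℝ≥0∞) ∂(gibbsMeasure φ N (Measure.dirac x))
  simp_rw [hg]
  rw [lintegral_gibbsMeasure_dirac hm N x hgc.measurable,
    lintegral_gibbsMeasure_dirac hm N x hfc.measurable, h.gibbsKernel_gibbsKernel hN]

end UniformBounds

theorem statement9 (A : ℕ → ℕ → Bool) (hA : NoDegenerate A)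
    (hmix : TopMixing A) (hbip : BIP A)
    (φ : Space A → ℝ) (hφ : Measurable φ) (hw : Walters A φ)
    (hvar : varn A φ 1 ≠ ⊤) (P : ℝ) (hP : HasGurevich A φ P) :
    (∃! μ : Measure (Space A), IsProbabilityMeasure μ ∧ IsDLR A φ μ) ∧
    (∀ μ : Measure (Space A), IsProbabilityMeasure μ →
      (IsDLR A φ μ ↔ ∃ l : ℝ, 0 < l ∧ NonSingular A μ ∧ Conformal A φ l μ)) := by
  obtain ⟨x₀, hx₀⟩ : ∃ x : Space A, x.1 0 = 0 := by
    obtain ⟨N, hN⟩ := hmix 0 0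
    obtain ⟨x, hx, -⟩ := hN (N + 1) (Nat.lt_succ_self N)
    exact ⟨x, hx⟩
  have : Nonempty (Space A) := ⟨x₀⟩
  have hZ : ∀ n, 1 ≤ n → Zn A φ n 0 ≠ ⊤ := by
    refine (hP 0 ⟨x₀, fun i => ?_⟩).1
    obtain ⟨i, hi⟩ := i
    obtain rfl : i = 0 := Nat.lt_one_iff.1 hi
    exact hx₀
  obtain ⟨u, m, K, q, h⟩ := exists_uniformBounds hmix hbip hw hvar hZ
  refine ⟨?_, fun μ hμ => ⟨fun hD => ?_, ?_⟩⟩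
  · obtain ⟨μ, hμ, hG⟩ := h.exists_gibbs (continuous_of_walters hw)
    refine ⟨μ, ⟨hμ, isDLR_of_isGibbs hφ fun n _ => hG n⟩, ?_⟩
    rintro ν ⟨hν, hD⟩
    exact h.gibbs_unique (fun n hn => isGibbs_of_isDLR hφ hD hn) fun n _ => hG n
  · obtain ⟨l, hl, hc⟩ := h.exists_conformal hφ fun n hn => isGibbs_of_isDLR hφ hD hn
    exact ⟨l, hl, h.nonSingular hφ (ENNReal.ofReal_pos.2 (inv_pos.2 hl)).ne'
      ((conformal_iff l hl μ).1 hc), hc⟩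
  · rintro ⟨l, hl, -, hc⟩
    exact isDLR_of_isGibbs hφ fun n _ => h.isGibbs_of_eq_smul hφ ((conformal_iff l hl μ).1 hc) n

end CMS
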